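/- arXiv:2301.01466 — 3 statements merged into one kernel-verified Lean document; each statement's English description precedes it below -/
import Mathlib

section
/- The Laplace transform of the one-parameter Mittag-Leffler function satisfies ∫₀^∞ e^{-s x} E_α(-λ x^α) dx = s^{α-1}/(λ + s^α) for all real s > 0, λ > 0, and 0 < α < 1. -/
/-- The one-parameter Mittag-Leffler function `E_α(x) = ∑ x^k / Γ(αk+1)`. -/
noncomputable def mittagLeffler (α x : ℝ) : ℝ :=
  ∑' k : ℕ, x ^ k / Real.Gamma (α * k + 1)

open MeasureTheory Set

theorem rpow_mul_exp_neg_le_Gamma_add_one {R y : ℝ} (hR : 0 ≤ R) (hy : 0 ≤ y) :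
    R ^ y * Real.exp (-R) ≤ Real.Gamma (y + 1) := by
  have hconv := Real.GammaIntegral_convergent (s := y + 1) (by linarith)
  rw [Real.Gamma_eq_integral (by linarith), ← integral_exp_neg_Ioi R, ← integral_const_mul]
  simp only [add_sub_cancel_right] at hconv ⊢
  calc ∫ x in Ioi R, R ^ y * Real.exp (-x)
      ≤ ∫ x in Ioi R, Real.exp (-x) * x ^ y := by
        refine setIntegral_mono_on ((integrableOn_exp_neg_Ioi R).const_mul _)
          (hconv.mono_set (Ioi_subset_Ioi hR)) measurableSet_Ioi fun x hx ↦ ?_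
        rw [mul_comm]
        gcongr
        exact (mem_Ioi.mp hx).le
    _ ≤ ∫ x in Ioi 0, Real.exp (-x) * x ^ y := by
        refine setIntegral_mono_set hconv ?_ (Ioi_subset_Ioi hR).eventuallyLE
        filter_upwards [ae_restrict_mem measurableSet_Ioi] with x hx
        have : 0 < x := hx
        simp only [Pi.zero_apply]
        positivity

/-- The terms of the Mittag-Leffler series are dominated by a geometric series, uniformly on
bounded sets. -/
theorem exists_abs_pow_div_Gamma_le {α : ℝ} (hα : 0 < α) {M : ℝ} (hM : 0 < M) :
    ∃ C : ℝ, ∀ (k : ℕ) (x : ℝ), |x| ≤ M →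
      |x ^ k / Real.Gamma (α * k + 1)| ≤ C * (1 / 2 : ℝ) ^ k := by
  set R : ℝ := (2 * M) ^ (1 / α) with hR
  have hR0 : 0 < R := by positivity
  refine ⟨Real.exp R, fun k x hx ↦ ?_⟩
  have hG := rpow_mul_exp_neg_le_Gamma_add_one hR0.le (by positivity : 0 ≤ α * k)
  have hRk : R ^ (α * k) = (2 * M) ^ k := by
    rw [hR, ← Real.rpow_mul (by positivity), ← Real.rpow_natCast]
    congr 1
    field_simp
  rw [hRk] at hG
  have hGpos : 0 < Real.Gamma (α * k + 1) := Real.Gamma_pos_of_pos (by positivity)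
  rw [abs_div, abs_pow, abs_of_pos hGpos, div_le_iff₀ hGpos]
  calc |x| ^ k ≤ M ^ k := by gcongr
    _ = Real.exp R * (1 / 2 : ℝ) ^ k * ((2 * M) ^ k * Real.exp (-R)) := by
        have h1 : Real.exp R * Real.exp (-R) = 1 := by rw [← Real.exp_add]; simp
        have h2 : (1 / 2 : ℝ) ^ k * (2 * M) ^ k = M ^ k := by
          rw [← mul_pow]; congr 1; ring
        linear_combination (-1 : ℝ) * h2 - (1 / 2 : ℝ) ^ k * (2 * M) ^ k * h1
    _ ≤ _ := by gcongr

theorem summable_mittagLeffler {α : ℝ} (hα : 0 < α) (x : ℝ) :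
    Summable fun k : ℕ ↦ x ^ k / Real.Gamma (α * k + 1) := by
  obtain ⟨C, hC⟩ := exists_abs_pow_div_Gamma_le hα (M := |x| + 1) (by positivity)
  exact .of_norm_bounded (summable_geometric_two.mul_left C) fun k ↦ hC k x (by linarith)

theorem continuous_mittagLeffler {α : ℝ} (hα : 0 < α) : Continuous (mittagLeffler α) := by
  refine continuous_iff_continuousAt.mpr fun x ↦ ?_
  obtain ⟨C, hC⟩ := exists_abs_pow_div_Gamma_le hα (M := |x| + 1) (by positivity)
  have hcont : ContinuousOn (mittagLeffler α) {y | |y| ≤ |x| + 1} :=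
    continuousOn_tsum (fun k ↦ by fun_prop) (summable_geometric_two.mul_left C)
      fun k y hy ↦ hC k y hy
  refine hcont.continuousAt (Filter.mem_of_superset
    ((isOpen_lt continuous_abs continuous_const).mem_nhds (?_ : |x| < |x| + 1)) ?_)
  · linarith
  · exact fun y (hy : |y| < |x| + 1) ↦ hy.le

theorem mittagLeffler_zero (α : ℝ) : mittagLeffler α 0 = 1 := by
  rw [mittagLeffler, tsum_eq_single 0 fun k hk ↦ by simp [hk]]
  simp

theorem integral_sub_rpow_mul_rpow {a b x : ℝ} (ha : 0 < a) (hb : 0 < b) (hx : 0 < x) :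
    ∫ t in (0 : ℝ)..x, (x - t) ^ (a - 1) * t ^ (b - 1) =
      x ^ (a + b - 1) * (Real.Gamma a * Real.Gamma b / Real.Gamma (a + b)) := by
  have h := Complex.betaIntegral_scaled b a hx
  rw [Complex.betaIntegral_eq_Gamma_mul_div _ _ (by simpa) (by simpa)] at h
  apply Complex.ofReal_injective
  rw [← intervalIntegral.integral_ofReal]
  push_cast
  rw [← Complex.ofReal_add, add_comm a b] at *
  push_cast [Complex.ofReal_cpow hx.le, ← Complex.Gamma_ofReal] at h ⊢
  rw [mul_comm (Complex.Gamma a), ← h]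
  refine intervalIntegral.integral_congr fun t ht ↦ ?_
  rw [uIcc_of_le hx.le] at ht
  rw [Complex.ofReal_cpow (sub_nonneg.mpr ht.2), Complex.ofReal_cpow ht.1]
  push_cast
  ring

theorem intervalIntegrable_sub_rpow {α : ℝ} (hα : 0 < α) (x a b : ℝ) :
    IntervalIntegrable (fun t ↦ (x - t) ^ (α - 1)) volume a b := by
  have h := (intervalIntegral.intervalIntegrable_rpow' (a := x - a) (b := x - b)
    (by linarith : -1 < α - 1)).comp_sub_left x
  simpa using h

theorem integral_sub_rpow_self {α : ℝ} (hα : 0 < α) (x a : ℝ) :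
    ∫ t in a..x, (x - t) ^ (α - 1) = (x - a) ^ α / α := by
  rw [intervalIntegral.integral_comp_sub_left (fun t ↦ t ^ (α - 1)),
    integral_rpow (Or.inl (by linarith))]
  simp [hα.ne']

/-- The function `x ↦ E_α(-λ x^α)` solves the Volterra equation of fractional relaxation. -/
theorem mittagLeffler_volterra {α lam x : ℝ} (hα : 0 < α) (hx : 0 < x) :
    mittagLeffler α (-(lam * x ^ α)) = 1 - lam / Real.Gamma α *
      ∫ t in (0 : ℝ)..x, (x - t) ^ (α - 1) * mittagLeffler α (-(lam * t ^ α)) := by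
  have hΓ : 0 < Real.Gamma α := Real.Gamma_pos_of_pos hα
  obtain ⟨C, hC⟩ := exists_abs_pow_div_Gamma_le hα (M := |lam| * x ^ α + 1) (by positivity)
  have hint := intervalIntegrable_sub_rpow hα x 0 x
  have hsum : HasSum (fun k : ℕ ↦ ∫ t in (0 : ℝ)..x,
      (x - t) ^ (α - 1) * ((-(lam * t ^ α)) ^ k / Real.Gamma (α * k + 1)))
      (∫ t in (0 : ℝ)..x, (x - t) ^ (α - 1) * mittagLeffler α (-(lam * t ^ α))) := by
    refine intervalIntegral.hasSum_integral_of_dominated_convergence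
      (fun k t ↦ (x - t) ^ (α - 1) * (C * (1 / 2 : ℝ) ^ k)) (fun k ↦ ?_) (fun k ↦ ?_)
      (ae_of_all _ fun t _ ↦ ?_) ?_ (ae_of_all _ fun t _ ↦ ?_)
    · refine Measurable.aestronglyMeasurable ?_
      fun_prop
    · refine ae_of_all _ fun t ht ↦ ?_
      rw [uIoc_of_le hx.le] at ht
      have hxt : 0 ≤ x - t := sub_nonneg.mpr ht.2
      rw [norm_mul, Real.norm_of_nonneg (by positivity), Real.norm_eq_abs]
      gcongr
      refine hC k _ ?_
      have : t ^ α ≤ x ^ α := Real.rpow_le_rpow ht.1.le ht.2 hα.le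
      rw [abs_neg, abs_mul, abs_of_nonneg (Real.rpow_nonneg ht.1.le α)]
      have := mul_le_mul_of_nonneg_left this (abs_nonneg lam)
      linarith
    · exact (summable_geometric_two.mul_left C).mul_left _
    · simp_rw [tsum_mul_left]
      exact hint.mul_const _
    · exact (summable_mittagLeffler hα _).hasSum.mul_left _
  have hterm (k : ℕ) : (-(lam * x ^ α)) ^ (k + 1) / Real.Gamma (α * (k + 1 : ℕ) + 1) =
      -(lam / Real.Gamma α) * ∫ t in (0 : ℝ)..x,
        (x - t) ^ (α - 1) * ((-(lam * t ^ α)) ^ k / Real.Gamma (α * k + 1)) := by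
    have hk : 0 < Real.Gamma (α * k + 1) := Real.Gamma_pos_of_pos (by positivity)
    have hk' : 0 < Real.Gamma (α + (α * k + 1)) := Real.Gamma_pos_of_pos (by positivity)
    have h1 : ∫ t in (0 : ℝ)..x,
        (x - t) ^ (α - 1) * ((-(lam * t ^ α)) ^ k / Real.Gamma (α * k + 1)) =
        (-lam) ^ k / Real.Gamma (α * k + 1) *
          ∫ t in (0 : ℝ)..x, (x - t) ^ (α - 1) * t ^ ((α * k + 1) - 1) := by
      rw [← intervalIntegral.integral_const_mul]
      refine intervalIntegral.integral_congr fun t ht ↦ ?_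
      rw [uIcc_of_le hx.le] at ht
      simp only [add_sub_cancel_right]
      rw [← neg_mul, mul_pow, Real.rpow_mul_natCast ht.1]
      ring
    rw [h1, integral_sub_rpow_mul_rpow hα (by positivity) hx,
      show α + (α * k + 1) - 1 = α * (k + 1 : ℕ) by push_cast; ring,
      show α * ((k + 1 : ℕ) : ℝ) + 1 = α + (α * k + 1) by push_cast; ring,
      Real.rpow_mul_natCast hx.le, ← neg_mul, mul_pow]
    field_simp
    ring
  rw [mittagLeffler, (summable_mittagLeffler hα _).tsum_eq_zero_add]
  simp_rw [hterm]
  rw [tsum_mul_left, hsum.tsum_eq]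
  simp
  ring

/-- A solution of the Volterra equation with decreasing kernel `t ^ (α - 1)` stays positive. -/
theorem pos_of_volterra {α c : ℝ} (hα : 0 < α) (hα1 : α < 1) (hc : 0 < c) {f : ℝ → ℝ}
    (hf : Continuous f) (hf0 : f 0 = 1)
    (hV : ∀ x, 0 < x → f x = 1 - c * ∫ t in (0 : ℝ)..x, (x - t) ^ (α - 1) * f t)
    {x : ℝ} (hx : 0 ≤ x) : 0 < f x := by
  by_contra! hneg
  let S : Set ℝ := Ici 0 ∩ f ⁻¹' Iic 0
  have hSc : IsClosed S := isClosed_Ici.inter (isClosed_Iic.preimage hf)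
  have hSb : BddBelow S := ⟨0, fun y hy ↦ hy.1⟩
  have hmem : sInf S ∈ S := hSc.csInf_mem ⟨x, hx, hneg⟩ hSb
  set b := sInf S
  have hfb : f b ≤ 0 := hmem.2
  have hb0 : 0 < b := by
    refine lt_of_le_of_ne hmem.1 fun h ↦ ?_
    rw [← h, hf0] at hfb
    linarith
  have hpos (y : ℝ) (hy0 : 0 ≤ y) (hyb : y < b) : 0 < f y := by
    by_contra! h
    exact absurd (csInf_le hSb ⟨hy0, h⟩) (not_le.mpr hyb)
  obtain ⟨δ, hδ, hδb, hδ1⟩ : ∃ δ : ℝ, 0 < δ ∧ δ ≤ b ∧ c * (δ ^ α / α) < 1 := by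
    have hlim : Filter.Tendsto (fun δ : ℝ ↦ c * (δ ^ α / α)) (nhdsWithin 0 (Ioi 0))
        (nhds (c * ((0 : ℝ) ^ α / α))) :=
      (((Real.continuousAt_rpow_const 0 α (Or.inr hα.le)).div_const α).const_mul c).tendsto.mono_left
        nhdsWithin_le_nhds
    rw [Real.zero_rpow hα.ne', zero_div, mul_zero] at hlim
    obtain ⟨δ, h1, h2⟩ := ((hlim.eventually (gt_mem_nhds one_pos)).and
      (Ioc_mem_nhdsGT hb0)).exists
    exact ⟨δ, h2.1, h2.2, h1⟩
  obtain ⟨a, ha, hmax⟩ := (isCompact_Icc (a := b - δ) (b := b)).exists_isMaxOn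
    ⟨b - δ, by simp [hδ.le]⟩ hf.continuousOn
  have hfa : 0 < f a :=
    (hpos (b - δ) (by linarith) (by linarith)).trans_le (hmax (by simp [hδ.le]))
  have hab : a < b := lt_of_le_of_ne ha.2 fun h ↦ by rw [h] at hfa; linarith
  have ha0 : 0 ≤ a := by linarith [ha.1]
  have hint (z u v : ℝ) : IntervalIntegrable (fun t ↦ (z - t) ^ (α - 1) * f t) volume u v :=
    (intervalIntegrable_sub_rpow hα z u v).mul_continuousOn hf.continuousOn
  have hVa : f a = 1 - c * ∫ t in (0 : ℝ)..a, (a - t) ^ (α - 1) * f t := by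
    rcases ha0.eq_or_lt with h | h
    · simp [← h, hf0]
    · exact hV a h
  have hVb := hV b hb0
  rw [← intervalIntegral.integral_add_adjacent_intervals (hint b 0 a) (hint b a b)] at hVb
  have hleft : ∫ t in (0 : ℝ)..a, (b - t) ^ (α - 1) * f t ≤
      ∫ t in (0 : ℝ)..a, (a - t) ^ (α - 1) * f t := by
    refine intervalIntegral.integral_mono_on_of_le_Ioo ha0 (hint b 0 a) (hint a 0 a)
      fun t ht ↦ ?_
    refine mul_le_mul_of_nonneg_right ?_ (hpos t ht.1.le (ht.2.trans hab)).le
    exact Real.rpow_le_rpow_of_nonpos (sub_pos.mpr ht.2) (by linarith) (by linarith)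
  have hright : ∫ t in a..b, (b - t) ^ (α - 1) * f t ≤ δ ^ α / α * f a := by
    calc ∫ t in a..b, (b - t) ^ (α - 1) * f t
        ≤ ∫ t in a..b, (b - t) ^ (α - 1) * f a := by
          refine intervalIntegral.integral_mono_on hab.le (hint b a b)
            ((intervalIntegrable_sub_rpow hα b a b).mul_const _) fun t ht ↦ ?_
          exact mul_le_mul_of_nonneg_left (hmax ⟨ha.1.trans ht.1, ht.2⟩)
            (Real.rpow_nonneg (sub_nonneg.mpr ht.2) _)
      _ = (b - a) ^ α / α * f a := by
          rw [intervalIntegral.integral_mul_const, integral_sub_rpow_self hα]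
      _ ≤ δ ^ α / α * f a := by
          gcongr
          linarith [ha.1]
  have hc1 := mul_le_mul_of_nonneg_left (add_le_add hleft hright) hc.le
  have hc2 := mul_lt_mul_of_pos_right hδ1 hfa
  linarith

/-- The Laplace transform of a bounded solution of the Volterra equation with kernel
`t ^ (α - 1)`. -/
theorem laplace_transform_of_volterra {α c s : ℝ} (hα : 0 < α) (hc : 0 < c) (hs : 0 < s)
    {f : ℝ → ℝ} (hf : Continuous f) {B : ℝ} (hB : ∀ x, 0 < x → |f x| ≤ B)
    (hV : ∀ x, 0 < x → f x = 1 - c * ∫ t in (0 : ℝ)..x, (x - t) ^ (α - 1) * f t) :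
    ∫ x in Ioi (0 : ℝ), Real.exp (-(s * x)) * f x =
      s ^ (α - 1) / (c * Real.Gamma α + s ^ α) := by
  have hΓ : 0 < Real.Gamma α := Real.Gamma_pos_of_pos hα
  have hE : IntegrableOn (fun x ↦ Real.exp (-(s * x))) (Ioi 0) := by
    simpa only [neg_mul] using exp_neg_integrableOn_Ioi 0 hs
  have hEint : ∫ x in Ioi (0 : ℝ), Real.exp (-(s * x)) = 1 / s := by
    simpa [neg_mul] using integral_exp_mul_Ioi (neg_lt_zero.mpr hs) 0
  have hEf : IntegrableOn (fun x ↦ Real.exp (-(s * x)) * f x) (Ioi 0) := by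
    refine Integrable.mono' (hE.mul_const B) (by fun_prop) ?_
    filter_upwards [ae_restrict_mem measurableSet_Ioi] with x hx
    rw [norm_mul, Real.norm_of_nonneg (Real.exp_nonneg _)]
    exact mul_le_mul_of_nonneg_left (hB x hx) (Real.exp_nonneg _)
  have hK : IntegrableOn (fun x ↦ x ^ (α - 1) * Real.exp (-(s * x))) (Ioi 0) := by
    simpa using integrableOn_rpow_mul_exp_neg_mul_rpow (by linarith : -1 < α - 1) one_pos hs
  have hconv := integral_posConvolution hEf hK (ContinuousLinearMap.mul ℝ ℝ)
  simp only [ContinuousLinearMap.mul_apply'] at hconv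
  rw [Real.integral_rpow_mul_exp_neg_mul_Ioi hα hs] at hconv
  have hlhs : ∫ x in Ioi (0 : ℝ), ∫ t in (0 : ℝ)..x, Real.exp (-(s * t)) * f t *
      ((x - t) ^ (α - 1) * Real.exp (-(s * (x - t)))) =
      ∫ x in Ioi (0 : ℝ), (Real.exp (-(s * x)) - Real.exp (-(s * x)) * f x) / c := by
    refine setIntegral_congr_fun measurableSet_Ioi fun x hx ↦ ?_
    have h1 : ∫ t in (0 : ℝ)..x, Real.exp (-(s * t)) * f t *
        ((x - t) ^ (α - 1) * Real.exp (-(s * (x - t)))) =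
        Real.exp (-(s * x)) * ∫ t in (0 : ℝ)..x, (x - t) ^ (α - 1) * f t := by
      rw [← intervalIntegral.integral_const_mul]
      congr 1 with t
      rw [show -(s * x) = -(s * t) + -(s * (x - t)) by ring, Real.exp_add]
      ring
    rw [h1, hV x hx]
    field_simp
    ring
  rw [hlhs, integral_div, integral_sub hE hEf, hEint, Real.div_rpow zero_le_one hs.le,
    Real.one_rpow] at hconv
  have hsα : 0 < s ^ α := by positivity
  rw [Real.rpow_sub_one hs.ne', eq_div_iff (by positivity)]
  field_simp at hconv ⊢
  linear_combination -hconv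

theorem laplace_transform_mittagLeffler (α lam s : ℝ)
    (hα : 0 < α) (hα1 : α < 1) (hlam : 0 < lam) (hs : 0 < s) :
    ∫ x in Set.Ioi (0 : ℝ), Real.exp (-(s * x)) * mittagLeffler α (-(lam * x ^ α)) =
      s ^ (α - 1) / (lam + s ^ α) := by
  have hΓ : 0 < Real.Gamma α := Real.Gamma_pos_of_pos hα
  have hc : 0 < lam / Real.Gamma α := div_pos hlam hΓ
  have hcont : Continuous fun x : ℝ ↦ mittagLeffler α (-(lam * x ^ α)) :=
    (continuous_mittagLeffler hα).comp
      ((Real.continuous_rpow_const hα.le).const_mul lam).neg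
  have hV (x : ℝ) (hx : 0 < x) := mittagLeffler_volterra (lam := lam) hα hx
  have hpos {x : ℝ} (hx : 0 ≤ x) : 0 < mittagLeffler α (-(lam * x ^ α)) :=
    pos_of_volterra hα hα1 hc hcont (by simp [hα.ne', mittagLeffler_zero]) hV hx
  have hle (x : ℝ) (hx : 0 < x) : |mittagLeffler α (-(lam * x ^ α))| ≤ 1 := by
    rw [abs_of_pos (hpos hx.le), hV x hx, sub_le_self_iff]
    refine mul_nonneg hc.le (intervalIntegral.integral_nonneg hx.le fun t ht ↦ ?_)
    exact mul_nonneg (Real.rpow_nonneg (sub_nonneg.mpr ht.2) _) (hpos ht.1).le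
  rw [laplace_transform_of_volterra hα hc hs hcont hle hV, div_mul_cancel₀ _ hΓ.ne']
end

section
/- For 0 < α < 1, γ > 0, β > αγ, and λ > 0, the Prabhakar function admits the representation E^γ_{α,β}(-λ x^α) = (x^{1-β}/Γ(γ)) ∫₀^∞ (ρ^γ_{α,β} ⋆ f_α)(x t^{-1/α}) t^{(β-1)/α - 1} e^{-λ t} dt for all x > 0, where ρ^γ_{α,β}(u) = u^{β-αγ-1}/Γ(β-αγ), f_α is the one-sided stable density, and ⋆ denotes Laplace convolution. Consequently E^γ_{α,β}(-x) is completely monotone on (0,∞) when β > αγ. -/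
/-- The three-parameter Mittag-Leffler (Prabhakar) function. -/
noncomputable def mittagLeffler3 (α β γ x : ℝ) : ℝ :=
  (1 / Real.Gamma γ) *
    ∑' k : ℕ, Real.Gamma (γ + k) / (Nat.factorial k * Real.Gamma (α * k + β)) * x ^ k

/-- Laplace convolution `(ρ ⋆ f)(x) = ∫₀^x ρ(x-u) f(u) du`. -/
noncomputable def lconv (ρ f : ℝ → ℝ) (x : ℝ) : ℝ :=
  ∫ u in Set.Ioo (0 : ℝ) x, ρ (x - u) * f u

def CompletelyMonotoneOn (φ : ℝ → ℝ) : Prop :=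
  ContDiffOn ℝ (⊤ : ℕ∞) φ (Set.Ioi 0) ∧
    ∀ n : ℕ, ∀ x > (0 : ℝ), 0 ≤ (-1 : ℝ) ^ n * iteratedDerivWithin n φ (Set.Ioi 0) x

open MeasureTheory Set Filter Topology
open scoped ENNReal Nat

theorem tendsto_Gamma_div_Gamma_add_atTop {a : ℝ} (ha : 0 < a) (ha1 : a < 1) :
    Tendsto (fun y => Real.Gamma y / Real.Gamma (y + a)) atTop (𝓝 0) := by
  have hlim : Tendsto (fun y : ℝ => ((y + a) / y) * (y + a) ^ (-a)) atTop (𝓝 0) := by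
    have h1 : Tendsto (fun y : ℝ => 1 + a / y) atTop (𝓝 (1 + 0)) :=
      tendsto_const_nhds.add (tendsto_const_nhds.div_atTop tendsto_id)
    have h2 : Tendsto (fun y : ℝ => (y + a) ^ (-a)) atTop (𝓝 0) :=
      (tendsto_rpow_neg_atTop ha).comp (tendsto_atTop_add_const_right _ a tendsto_id)
    have h3 := h1.mul h2
    rw [mul_zero] at h3
    refine h3.congr' ?_
    filter_upwards [eventually_gt_atTop 0] with y hy
    congr 1
    field_simp
  refine squeeze_zero' ?_ ?_ hlim
  · filter_upwards [eventually_gt_atTop 0] with y hy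
    exact div_nonneg (Real.Gamma_pos_of_pos hy).le (Real.Gamma_pos_of_pos (by linarith)).le
  · filter_upwards [eventually_gt_atTop 0] with y hy
    have hya : 0 < y + a := by linarith
    have hG := Real.Gamma_pos_of_pos hya
    have h := Real.Gamma_mul_add_mul_le_rpow_Gamma_mul_rpow_Gamma hya
      (show 0 < y + a + 1 by linarith) ha (sub_pos.2 ha1) (add_sub_cancel a 1)
    rw [show a * (y + a) + (1 - a) * (y + a + 1) = y + 1 by ring, Real.Gamma_add_one hy.ne',
      Real.Gamma_add_one hya.ne', Real.mul_rpow hya.le hG.le, mul_left_comm, ← Real.rpow_add hG,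
      add_sub_cancel, Real.rpow_one] at h
    rw [div_le_iff₀ hG, ← mul_le_mul_iff_right₀ hy]
    refine h.trans_eq ?_
    rw [sub_eq_add_neg, Real.rpow_add hya, Real.rpow_one]
    field_simp

theorem summable_Gamma_div_Gamma_mul_pow {α β γ : ℝ} (hα : 0 < α) (hα1 : α < 1) (hγ : 0 < γ)
    (hβ : 0 < β) (z : ℝ) :
    Summable fun k : ℕ => Real.Gamma (γ + k) / Real.Gamma (α * k + β) * z ^ k / k ! := by
  rcases eq_or_ne z 0 with rfl | hz
  · exact summable_of_ne_finset_zero (s := {0}) fun k hk => by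
      simp [zero_pow (by simpa using hk : k ≠ 0)]
  have hg (k : ℕ) : 0 < Real.Gamma (γ + k) := Real.Gamma_pos_of_pos (by positivity)
  have hb (k : ℕ) : 0 < Real.Gamma (α * k + β) := Real.Gamma_pos_of_pos (by positivity)
  refine summable_of_ratio_test_tendsto_lt_one zero_lt_one (Eventually.of_forall fun k => ?_) ?_
  · have := hg k
    have := hb k
    positivity
  have h1 : Tendsto (fun k : ℕ => Real.Gamma (α * k + β) / Real.Gamma (α * k + β + α)) atTop
      (𝓝 0) :=
    (tendsto_Gamma_div_Gamma_add_atTop hα hα1).comp <| tendsto_atTop_add_const_right _ _ <|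
      tendsto_natCast_atTop_atTop.const_mul_atTop hα
  have h2 : Tendsto (fun k : ℕ => (γ + k) / ((k : ℝ) + 1)) atTop (𝓝 (0 + 1)) := by
    have h : Tendsto (fun k : ℕ => (γ - 1) / ((k : ℝ) + 1) + 1) atTop (𝓝 (0 + 1)) :=
      (tendsto_const_nhds.div_atTop
        (tendsto_atTop_add_const_right _ _ tendsto_natCast_atTop_atTop)).add tendsto_const_nhds
    refine h.congr fun k => ?_
    field_simp
    ring
  have h3 := (h1.mul h2).mul_const |z|
  rw [zero_mul, zero_mul] at h3
  refine h3.congr fun k => ?_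
  have hg1 : Real.Gamma (γ + (k + 1 : ℕ)) = (γ + k) * Real.Gamma (γ + k) := by
    rw [← Real.Gamma_add_one (by positivity)]
    push_cast
    ring_nf
  have hb1 : α * ((k + 1 : ℕ) : ℝ) + β = α * k + β + α := by
    push_cast
    ring
  have hb2 : 0 < Real.Gamma (α * k + β + α) := Real.Gamma_pos_of_pos (by positivity)
  have := hg k
  have := hb k
  rw [hg1, hb1, Nat.factorial_succ]
  simp only [norm_div, norm_mul, norm_pow, Real.norm_eq_abs, abs_of_pos (hg k), abs_of_pos (hb k),
    abs_of_pos hb2, Nat.abs_cast, abs_of_pos (show 0 < γ + k by positivity)]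
  push_cast
  have := abs_pos.2 hz
  field_simp
  ring

theorem integrable_exp_mul_of_moments {μ : Measure ℝ} (hμ : ∀ᵐ x ∂μ, 0 < x) {m : ℕ → ℝ}
    (hm0 : ∀ k, 0 ≤ m k) (hm : ∀ k, ∫⁻ x, ENNReal.ofReal (x ^ k) ∂μ = ENNReal.ofReal (m k))
    (hs : ∀ z, Summable fun k : ℕ => m k * z ^ k / k !) (t : ℝ) :
    Integrable (fun x => Real.exp (t * x)) μ := by
  have habs : Integrable (fun x => Real.exp (|t| * x)) μ := by
    refine ⟨by fun_prop, ?_⟩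
    rw [hasFiniteIntegral_iff_ofReal (Eventually.of_forall fun x => (Real.exp_pos _).le)]
    have h : ∫⁻ x, ENNReal.ofReal (Real.exp (|t| * x)) ∂μ
        = ∫⁻ x, ∑' k : ℕ, ENNReal.ofReal (|t| ^ k / k !) * ENNReal.ofReal (x ^ k) ∂μ := by
      refine lintegral_congr_ae ?_
      filter_upwards [hμ] with x hx
      have h2 : (fun k : ℕ => ENNReal.ofReal (|t| ^ k / k !) * ENNReal.ofReal (x ^ k))
          = fun k : ℕ => ENNReal.ofReal ((|t| * x) ^ k / k !) := by
        ext k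
        rw [← ENNReal.ofReal_mul (by positivity)]
        congr 1
        ring
      rw [h2, ← ENNReal.ofReal_tsum_of_nonneg (fun k => by positivity)
        (Real.summable_pow_div_factorial _), Real.exp_eq_exp_ℝ, NormedSpace.exp_eq_tsum_div]
    have h3 : (fun k : ℕ => ENNReal.ofReal (|t| ^ k / k !) * ENNReal.ofReal (m k))
        = fun k : ℕ => ENNReal.ofReal (m k * |t| ^ k / k !) := by
      ext k
      rw [← ENNReal.ofReal_mul (by positivity)]
      congr 1
      ring
    have h4 (k : ℕ) : ∫⁻ x, ENNReal.ofReal (|t| ^ k / k !) * ENNReal.ofReal (x ^ k) ∂μ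
        = ENNReal.ofReal (|t| ^ k / k !) * ENNReal.ofReal (m k) := by
      rw [lintegral_const_mul _ (by fun_prop), hm]
    rw [h, lintegral_tsum fun k => by fun_prop]
    simp_rw [h4]
    rw [h3, ← ENNReal.ofReal_tsum_of_nonneg
      (fun k => div_nonneg (mul_nonneg (hm0 k) (by positivity)) (by positivity)) (hs _)]
    exact ENNReal.ofReal_lt_top
  refine habs.mono' (by fun_prop) ?_
  filter_upwards [hμ] with x hx
  rw [Real.norm_eq_abs, Real.abs_exp]
  gcongr
  exact le_abs_self t

theorem mgf_eq_tsum_of_moments {μ : Measure ℝ} (hμ : ∀ᵐ x ∂μ, 0 < x) {m : ℕ → ℝ}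
    (hm0 : ∀ k, 0 ≤ m k) (hm : ∀ k, ∫⁻ x, ENNReal.ofReal (x ^ k) ∂μ = ENNReal.ofReal (m k))
    (hs : ∀ z, Summable fun k : ℕ => m k * z ^ k / k !) (t : ℝ) :
    ProbabilityTheory.mgf id μ t = ∑' k : ℕ, m k * t ^ k / k ! := by
  have hpow (k : ℕ) : 0 ≤ᵐ[μ] fun x : ℝ => x ^ k := by
    filter_upwards [hμ] with x hx using pow_nonneg hx.le k
  have hint (k : ℕ) : Integrable (fun x : ℝ => x ^ k) μ :=
    ⟨by fun_prop, by
      rw [hasFiniteIntegral_iff_ofReal (hpow k), hm]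
      exact ENNReal.ofReal_lt_top⟩
  have hval (k : ℕ) : ∫ x, x ^ k ∂μ = m k := by
    rw [integral_eq_lintegral_of_nonneg_ae (hpow k) (by fun_prop), hm,
      ENNReal.toReal_ofReal (hm0 k)]
  have h := hasSum_integral_of_summable_integral_norm (μ := μ)
    (F := fun (k : ℕ) (x : ℝ) => t ^ k / k ! * x ^ k) (fun k => (hint k).const_mul _) (by
      refine (hs |t|).congr fun k => ?_
      have : ∀ᵐ x ∂μ, ‖t ^ k / k ! * x ^ k‖ = |t| ^ k / k ! * x ^ k := by
        filter_upwards [hμ] with x hx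
        simp [abs_of_pos hx]
      rw [integral_congr_ae this, integral_const_mul, hval]
      ring)
  simp_rw [integral_const_mul, hval] at h
  have h2 : ProbabilityTheory.mgf id μ t = ∫ x, ∑' k : ℕ, t ^ k / k ! * x ^ k ∂μ := by
    rw [ProbabilityTheory.mgf]
    refine integral_congr_ae (Eventually.of_forall fun x => ?_)
    simp only [id, Real.exp_eq_exp_ℝ, NormedSpace.exp_eq_tsum_div]
    refine tsum_congr fun k => ?_
    rw [mul_pow]
    ring
  rw [h2, ← h.tsum_eq]
  exact tsum_congr fun k => by ring

theorem completelyMonotoneOn_const_mul_mgf_neg {μ : Measure ℝ} (hμ : ∀ᵐ x ∂μ, 0 < x)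
    (hint : ∀ t, Integrable (fun x => Real.exp (t * x)) μ) {c : ℝ} (hc : 0 ≤ c) :
    CompletelyMonotoneOn fun x => c * ProbabilityTheory.mgf id μ (-x) := by
  have hset : ProbabilityTheory.integrableExpSet id μ = univ := eq_univ_of_forall hint
  have hmem (t : ℝ) : t ∈ interior (ProbabilityTheory.integrableExpSet id μ) := by simp [hset]
  have hsmooth : ContDiff ℝ (⊤ : ℕ∞) fun x => ProbabilityTheory.mgf id μ (-x) :=
    ContDiff.comp (g := ProbabilityTheory.mgf id μ)
      (contDiff_iff_contDiffAt.2 fun x => (ProbabilityTheory.analyticAt_mgf (hmem x)).contDiffAt)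
      contDiff_neg
  refine ⟨(contDiff_const.mul hsmooth).contDiffOn, fun n x hx => ?_⟩
  rw [iteratedDerivWithin_of_isOpen isOpen_Ioi hx, iteratedDeriv_const_mul_field,
    iteratedDeriv_comp_neg, ProbabilityTheory.iteratedDeriv_mgf (hmem _), smul_eq_mul,
    mul_left_comm, ← mul_assoc ((-1 : ℝ) ^ n), ← mul_pow, neg_one_mul, neg_neg, one_pow, one_mul]
  refine mul_nonneg hc (integral_nonneg_of_ae ?_)
  filter_upwards [hμ] with y hy
  simp only [id, Pi.zero_apply]
  positivity

/-- Laplace convolution of a density with an extended nonnegative function. -/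
noncomputable def lconvENN (ρ : ℝ → ℝ) (F : ℝ → ℝ≥0∞) (y : ℝ) : ℝ≥0∞ :=
  ∫⁻ u in Ioo 0 y, ENNReal.ofReal (ρ (y - u)) * F u

theorem lconvENN_eq_indicator (ρ : ℝ → ℝ) (F : ℝ → ℝ≥0∞) (y : ℝ) :
    lconvENN ρ F y =
      ∫⁻ u in Ioi 0, (Ioi 0).indicator (fun v => ENNReal.ofReal (ρ v)) (y - u) * F u := by
  rw [lconvENN, ← lintegral_indicator measurableSet_Ioo, ← lintegral_indicator measurableSet_Ioi]
  congr 1 with u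
  simp only [indicator_apply, mem_Ioo, mem_Ioi, sub_pos]
  by_cases h1 : 0 < u <;> by_cases h2 : u < y <;> simp [h1, h2]

theorem measurable_lconvENN_kernel {ρ : ℝ → ℝ} (hρ : Measurable ρ) {F : ℝ → ℝ≥0∞}
    (hF : Measurable F) : Measurable fun p : ℝ × ℝ =>
      (Ioi 0).indicator (fun v => ENNReal.ofReal (ρ v)) (p.1 - p.2) * F p.2 :=
  ((hρ.ennreal_ofReal.indicator measurableSet_Ioi).comp (measurable_fst.sub measurable_snd)).mul
    (hF.comp measurable_snd)

theorem measurable_lconvENN {ρ : ℝ → ℝ} (hρ : Measurable ρ) {F : ℝ → ℝ≥0∞}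
    (hF : Measurable F) : Measurable (lconvENN ρ F) := by
  simp_rw [funext (lconvENN_eq_indicator ρ F)]
  exact (measurable_lconvENN_kernel hρ hF).lintegral_prod_right'

theorem lintegral_exp_mul_lconvENN {ρ : ℝ → ℝ} (hρ : Measurable ρ) {F : ℝ → ℝ≥0∞}
    (hF : Measurable F) (s : ℝ) :
    ∫⁻ y in Ioi 0, ENNReal.ofReal (Real.exp (-(s * y))) * lconvENN ρ F y =
      (∫⁻ v in Ioi 0, ENNReal.ofReal (Real.exp (-(s * v))) * ENNReal.ofReal (ρ v)) *
        ∫⁻ u in Ioi 0, ENNReal.ofReal (Real.exp (-(s * u))) * F u := by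
  set R : ℝ → ℝ≥0∞ := (Ioi 0).indicator fun v => ENNReal.ofReal (ρ v) with hR
  have hRm : Measurable R := hρ.ennreal_ofReal.indicator measurableSet_Ioi
  have hE : Measurable fun y : ℝ => ENNReal.ofReal (Real.exp (-(s * y))) := by fun_prop
  have hexp (u v : ℝ) : ENNReal.ofReal (Real.exp (-(s * (u + v)))) =
      ENNReal.ofReal (Real.exp (-(s * u))) * ENNReal.ofReal (Real.exp (-(s * v))) := by
    rw [← ENNReal.ofReal_mul (Real.exp_pos _).le, ← Real.exp_add]
    ring_nf
  have hK := measurable_lconvENN_kernel hρ hF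
  have hKy (y : ℝ) : Measurable fun u => R (y - u) * F u := hK.comp measurable_prodMk_left
  calc
    _ = ∫⁻ y, ENNReal.ofReal (Real.exp (-(s * y))) * lconvENN ρ F y := by
      rw [← lintegral_indicator measurableSet_Ioi]
      congr 1 with y
      by_cases hy : 0 < y
      · simp [hy]
      · simp [hy, lconvENN]
    _ = ∫⁻ y, ∫⁻ u in Ioi 0, ENNReal.ofReal (Real.exp (-(s * y))) * (R (y - u) * F u) := by
      congr 1 with y
      rw [lconvENN_eq_indicator, lintegral_const_mul _ (hKy y)]
    _ = ∫⁻ u in Ioi 0, ∫⁻ y, ENNReal.ofReal (Real.exp (-(s * y))) * (R (y - u) * F u) :=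
      lintegral_lintegral_swap ((hE.comp measurable_fst).mul hK).aemeasurable
    _ = ∫⁻ u in Ioi 0, (∫⁻ v, ENNReal.ofReal (Real.exp (-(s * v))) * R v) *
          (ENNReal.ofReal (Real.exp (-(s * u))) * F u) := by
      congr 1 with u
      rw [← lintegral_mul_const _ (by fun_prop)]
      conv_rhs => rw [← lintegral_sub_right_eq_self _ u]
      congr 1 with y
      have hy := hexp u (y - u)
      rw [add_sub_cancel] at hy
      rw [hy]
      ring
    _ = _ := by
      rw [lintegral_const_mul _ (by fun_prop)]
      congr 1
      rw [← lintegral_indicator measurableSet_Ioi]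
      congr 1 with v
      by_cases hv : 0 < v <;> simp [hR, hv]

theorem lintegral_ofReal_eq_of_integral_pos {s : Set ℝ} (hs : MeasurableSet s) {g : ℝ → ℝ} {c : ℝ}
    (hg : ∀ x ∈ s, 0 ≤ g x) (hc : 0 < c) (h : ∫ x in s, g x = c) :
    ∫⁻ x in s, ENNReal.ofReal (g x) = ENNReal.ofReal c := by
  have hint : IntegrableOn g s := by
    by_contra hn
    rw [integral_undef hn] at h
    exact hc.ne h
  rw [← h, ofReal_integral_eq_lintegral_ofReal hint (ae_restrict_of_forall_mem hs hg)]

theorem lintegral_rpow_mul_exp_neg_mul_Ioi {a r : ℝ} (ha : 0 < a) (hr : 0 < r) :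
    ∫⁻ t in Ioi 0, ENNReal.ofReal (t ^ (a - 1)) * ENNReal.ofReal (Real.exp (-(r * t))) =
      ENNReal.ofReal ((1 / r) ^ a * Real.Gamma a) := by
  have := Real.Gamma_pos_of_pos ha
  rw [← lintegral_ofReal_eq_of_integral_pos measurableSet_Ioi (fun t ht => ?_) (by positivity)
    (Real.integral_rpow_mul_exp_neg_mul_Ioi ha hr)]
  · refine setLIntegral_congr_fun measurableSet_Ioi fun t ht => ?_
    rw [mem_Ioi] at ht
    rw [← ENNReal.ofReal_mul (by positivity)]
  · rw [mem_Ioi] at ht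
    positivity

section Stable

variable {α δ : ℝ} {F : ℝ → ℝ≥0∞}

theorem measurable_rpow_div_Gamma (δ : ℝ) :
    Measurable fun u : ℝ => u ^ (δ - 1) / Real.Gamma δ := by fun_prop

theorem laplace_lconvENN_stable (hδ : 0 < δ) (hF : Measurable F)
    (hL : ∀ s > (0 : ℝ), ∫⁻ u in Ioi 0, ENNReal.ofReal (Real.exp (-(s * u))) * F u =
      ENNReal.ofReal (Real.exp (-(s ^ α)))) {s : ℝ} (hs : 0 < s) :
    ∫⁻ y in Ioi 0, ENNReal.ofReal (Real.exp (-(s * y))) *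
        lconvENN (fun u => u ^ (δ - 1) / Real.Gamma δ) F y =
      ENNReal.ofReal (s ^ (-δ) * Real.exp (-(s ^ α))) := by
  have hG := Real.Gamma_pos_of_pos hδ
  rw [lintegral_exp_mul_lconvENN (measurable_rpow_div_Gamma δ) hF, hL s hs,
    ENNReal.ofReal_mul (by positivity)]
  congr 1
  have h (v : ℝ) : ENNReal.ofReal (Real.exp (-(s * v))) *
      ENNReal.ofReal (v ^ (δ - 1) / Real.Gamma δ) = ENNReal.ofReal (1 / Real.Gamma δ) *
        (ENNReal.ofReal (v ^ (δ - 1)) * ENNReal.ofReal (Real.exp (-(s * v)))) := by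
    rw [div_eq_mul_one_div, ENNReal.ofReal_mul' (by positivity)]
    ring
  simp_rw [h]
  rw [lintegral_const_mul _ (by fun_prop), lintegral_rpow_mul_exp_neg_mul_Ioi hδ hs,
    ← ENNReal.ofReal_mul (by positivity), one_div s, Real.inv_rpow hs.le, Real.rpow_neg hs.le]
  congr 1
  field_simp

theorem lintegral_rpow_neg_mul_lconvENN_stable (hα : 0 < α) (hδ : 0 < δ) (hF : Measurable F)
    (hL : ∀ s > (0 : ℝ), ∫⁻ u in Ioi 0, ENNReal.ofReal (Real.exp (-(s * u))) * F u =
      ENNReal.ofReal (Real.exp (-(s ^ α)))) {q : ℝ} (hq : δ < q) :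
    ∫⁻ y in Ioi 0, ENNReal.ofReal (y ^ (-q)) *
        lconvENN (fun u => u ^ (δ - 1) / Real.Gamma δ) F y =
      ENNReal.ofReal (1 / α * Real.Gamma ((q - δ) / α) / Real.Gamma q) := by
  set H := lconvENN (fun u => u ^ (δ - 1) / Real.Gamma δ) F
  have hHm : Measurable H := measurable_lconvENN (measurable_rpow_div_Gamma δ) hF
  have hq0 : 0 < q := hδ.trans hq
  have hG := Real.Gamma_pos_of_pos hq0
  have hG2 : 0 < Real.Gamma ((q - δ) / α) :=
    Real.Gamma_pos_of_pos (div_pos (sub_pos.2 hq) hα)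
  set c := ENNReal.ofReal (1 / Real.Gamma q) with hc
  calc
    _ = ∫⁻ y in Ioi 0, ∫⁻ s in Ioi 0, c * ENNReal.ofReal (s ^ (q - 1)) *
          (ENNReal.ofReal (Real.exp (-(s * y))) * H y) := by
      refine setLIntegral_congr_fun measurableSet_Ioi fun y hy => ?_
      rw [mem_Ioi] at hy
      have h1 (s : ℝ) : c * ENNReal.ofReal (s ^ (q - 1)) *
          (ENNReal.ofReal (Real.exp (-(s * y))) * H y) = c * (ENNReal.ofReal (s ^ (q - 1)) *
            ENNReal.ofReal (Real.exp (-(y * s)))) * H y := by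
        rw [mul_comm s y]
        ring
      simp_rw [h1]
      rw [lintegral_mul_const _ (by fun_prop), lintegral_const_mul _ (by fun_prop),
        lintegral_rpow_mul_exp_neg_mul_Ioi hq0 hy, hc, ← ENNReal.ofReal_mul (by positivity)]
      congr 2
      rw [one_div y, Real.inv_rpow hy.le, Real.rpow_neg hy.le]
      field_simp
    _ = ∫⁻ s in Ioi 0, ∫⁻ y in Ioi 0, c * ENNReal.ofReal (s ^ (q - 1)) *
          (ENNReal.ofReal (Real.exp (-(s * y))) * H y) :=
      lintegral_lintegral_swap (by unfold Function.uncurry; fun_prop)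
    _ = ∫⁻ s in Ioi 0, c * ENNReal.ofReal (s ^ (q - 1 - δ) * Real.exp (-s ^ α)) := by
      refine setLIntegral_congr_fun measurableSet_Ioi fun s hs => ?_
      rw [mem_Ioi] at hs
      rw [lintegral_const_mul _ (by fun_prop), laplace_lconvENN_stable hδ hF hL hs, mul_assoc,
        ← ENNReal.ofReal_mul (by positivity), ← mul_assoc, ← Real.rpow_add hs, ← sub_eq_add_neg]
    _ = _ := by
      rw [lintegral_const_mul _ (by fun_prop), lintegral_ofReal_eq_of_integral_pos
        measurableSet_Ioi (fun t ht => ?_) ?_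
        (integral_rpow_mul_exp_neg_rpow hα (q := q - 1 - δ) (by linarith)), hc,
        ← ENNReal.ofReal_mul (by positivity)]
      · congr 1
        rw [show q - 1 - δ + 1 = q - δ by ring]
        ring
      · rw [show q - 1 - δ + 1 = q - δ by ring]
        positivity
      · rw [mem_Ioi] at ht
        positivity

theorem lintegral_comp_rpow_neg_Ioi (hα : 0 < α) (g : ℝ → ℝ≥0∞) :
    ∫⁻ x in Ioi 0, g x =
      ∫⁻ y in Ioi 0, ENNReal.ofReal (α * y ^ (-α - 1)) * g (y ^ (-α)) := by
  have himg : (fun y : ℝ => y ^ (-α)) '' Ioi 0 = Ioi 0 := by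
    ext x
    constructor
    · rintro ⟨y, hy, rfl⟩
      exact Real.rpow_pos_of_pos hy _
    · intro hx
      refine ⟨x ^ (-α)⁻¹, Real.rpow_pos_of_pos hx _, ?_⟩
      exact Real.rpow_inv_rpow (le_of_lt hx) (neg_ne_zero.2 hα.ne')
  have hinj : InjOn (fun y : ℝ => y ^ (-α)) (Ioi 0) := fun x hx y hy h =>
    (Real.rpow_left_inj (le_of_lt hx) (le_of_lt hy) (neg_ne_zero.2 hα.ne')).1 h
  conv_lhs => rw [← himg]
  rw [lintegral_image_eq_lintegral_abs_deriv_mul measurableSet_Ioi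
    (fun x hx => (Real.hasDerivAt_rpow_const (Or.inl (ne_of_gt hx))).hasDerivWithinAt) hinj]
  refine setLIntegral_congr_fun measurableSet_Ioi fun y hy => ?_
  rw [mem_Ioi] at hy
  rw [abs_mul, abs_neg, abs_of_pos hα, abs_of_pos (Real.rpow_pos_of_pos hy _)]

theorem lintegral_moment_lconvENN_stable {β γ : ℝ} (hα : 0 < α) (hγ : 0 < γ)
    (hβ : α * γ < β) (hF : Measurable F)
    (hL : ∀ s > (0 : ℝ), ∫⁻ u in Ioi 0, ENNReal.ofReal (Real.exp (-(s * u))) * F u =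
      ENNReal.ofReal (Real.exp (-(s ^ α)))) (k : ℕ) :
    ∫⁻ τ in Ioi 0, lconvENN (fun u => u ^ (β - α * γ - 1) / Real.Gamma (β - α * γ)) F
          (τ ^ (-(1 / α))) * ENNReal.ofReal (τ ^ ((β - 1) / α - 1)) * ENNReal.ofReal (τ ^ k) =
      ENNReal.ofReal (Real.Gamma (γ + k) / Real.Gamma (α * k + β)) := by
  set H := lconvENN (fun u => u ^ (β - α * γ - 1) / Real.Gamma (β - α * γ)) F
  have hHm : Measurable H := measurable_lconvENN (measurable_rpow_div_Gamma _) hF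
  have hk : (0 : ℝ) ≤ k := k.cast_nonneg
  rw [lintegral_comp_rpow_neg_Ioi hα]
  have h : ∀ y ∈ Ioi (0 : ℝ), ENNReal.ofReal (α * y ^ (-α - 1)) * (H ((y ^ (-α)) ^ (-(1 / α))) *
      ENNReal.ofReal ((y ^ (-α)) ^ ((β - 1) / α - 1)) * ENNReal.ofReal ((y ^ (-α)) ^ k)) =
        ENNReal.ofReal α * (ENNReal.ofReal (y ^ (-(α * k + β))) * H y) := by
    intro y hy
    rw [mem_Ioi] at hy
    rw [← Real.rpow_natCast, ← Real.rpow_mul hy.le, ← Real.rpow_mul hy.le, ← Real.rpow_mul hy.le,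
      show -α * -(1 / α) = 1 by field_simp, Real.rpow_one,
      show -(α * k + β) = (-α - 1) + -α * ((β - 1) / α - 1) + -α * k by field_simp; ring,
      Real.rpow_add hy, Real.rpow_add hy, ENNReal.ofReal_mul hα.le,
      ENNReal.ofReal_mul (by positivity), ENNReal.ofReal_mul (by positivity)]
    ring
  have hGk := Real.Gamma_pos_of_pos (show 0 < γ + k by positivity)
  rw [setLIntegral_congr_fun measurableSet_Ioi h, lintegral_const_mul _ (by fun_prop),
    lintegral_rpow_neg_mul_lconvENN_stable hα (sub_pos.2 hβ) hF hL
      (by nlinarith [mul_pos hα hγ, mul_nonneg hα.le hk]), ← ENNReal.ofReal_mul hα.le,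
    show (α * k + β - (β - α * γ)) / α = γ + k by field_simp; ring]
  congr 1
  field_simp

end Stable

theorem lconv_eq_toReal_lconvENN {ρ : ℝ → ℝ} (hρ : Measurable ρ) (hρ0 : ∀ v > 0, 0 ≤ ρ v)
    {f : ℝ → ℝ} (hfm : AEMeasurable f (volume.restrict (Ioi 0))) (hf0 : ∀ x > 0, 0 ≤ f x)
    {F : ℝ → ℝ≥0∞} (hF : (fun x => ENNReal.ofReal (f x)) =ᵐ[volume.restrict (Ioi 0)] F) (y : ℝ) :
    lconv ρ f y = (lconvENN ρ F y).toReal := by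
  have hle : volume.restrict (Ioo 0 y) ≤ volume.restrict (Ioi 0) :=
    Measure.restrict_mono Ioo_subset_Ioi_self le_rfl
  have hpos : ∀ u ∈ Ioo 0 y, 0 ≤ ρ (y - u) := fun u hu => hρ0 _ (sub_pos.2 hu.2)
  rw [lconv, integral_eq_lintegral_of_nonneg_ae
    (ae_restrict_of_forall_mem measurableSet_Ioo fun u hu =>
      mul_nonneg (hpos u hu) (hf0 u hu.1))
    ((hρ.comp (measurable_const.sub measurable_id)).aemeasurable.mul
      (hfm.mono_measure hle)).aestronglyMeasurable, lconvENN]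
  congr 1
  refine lintegral_congr_ae ?_
  filter_upwards [hF.filter_mono (ae_mono hle), ae_restrict_mem measurableSet_Ioo] with u hu hmem
  rw [ENNReal.ofReal_mul (hpos u hmem), hu]

theorem setIntegral_comp_mul_rpow_neg_inv {α β lam x : ℝ} (hα : 0 < α) (hx : 0 < x) (K : ℝ → ℝ) :
    x ^ (1 - β) * ∫ t in Ioi (0 : ℝ), K (x * t ^ (-(1 / α))) * t ^ ((β - 1) / α - 1) *
        Real.exp (-(lam * t)) =
      ∫ τ in Ioi (0 : ℝ), K (τ ^ (-(1 / α))) * τ ^ ((β - 1) / α - 1) *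
        Real.exp (-(lam * x ^ α) * τ) := by
  have hxα : 0 < x ^ α := Real.rpow_pos_of_pos hx α
  have h := integral_comp_mul_left_Ioi' (fun t => K (x * t ^ (-(1 / α))) *
    t ^ ((β - 1) / α - 1) * Real.exp (-(lam * t))) 0 hxα
  rw [mul_zero] at h
  rw [← h, smul_eq_mul, ← mul_assoc, ← integral_const_mul]
  refine setIntegral_congr_fun measurableSet_Ioi fun τ hτ => ?_
  rw [mem_Ioi] at hτ
  have h1 : x * (x ^ α * τ) ^ (-(1 / α)) = τ ^ (-(1 / α)) := by
    rw [Real.mul_rpow hxα.le hτ.le, ← Real.rpow_mul hx.le, show α * -(1 / α) = -1 by field_simp,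
      Real.rpow_neg_one, mul_inv_cancel_left₀ hx.ne']
  have h2 : x ^ (1 - β) * x ^ α * (x ^ α * τ) ^ ((β - 1) / α - 1) = τ ^ ((β - 1) / α - 1) := by
    rw [Real.mul_rpow hxα.le hτ.le, ← Real.rpow_mul hx.le, ← mul_assoc, ← Real.rpow_add hx,
      ← Real.rpow_add hx, show 1 - β + α + α * ((β - 1) / α - 1) = 0 by field_simp; ring,
      Real.rpow_zero, one_mul]
  rw [h1, ← h2]
  ring_nf

/-- The Prabhakar function is, up to the factor `1 / Γ(γ)`, the moment generating function of the
measure with density `τ ↦ (ρ ⋆ f)(τ ^ (-1 / α)) * τ ^ ((β - 1) / α - 1)` on `(0, ∞)`. -/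
theorem exists_measure_mittagLeffler3_eq_mgf {α β γ : ℝ} (hα : 0 < α) (hα1 : α < 1)
    (hγ : 0 < γ) (hβ : α * γ < β) {f : ℝ → ℝ} (hf_pos : ∀ x > (0 : ℝ), 0 < f x)
    (hf_int : IntegrableOn f (Ioi 0))
    (hf_lt : ∀ s > (0 : ℝ),
      ∫ t in Ioi (0 : ℝ), Real.exp (-(s * t)) * f t = Real.exp (-(s ^ α))) :
    ∃ μ : Measure ℝ, (∀ᵐ x ∂μ, 0 < x) ∧ (∀ t, Integrable (fun x => Real.exp (t * x)) μ) ∧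
      (∀ z, mittagLeffler3 α β γ z = 1 / Real.Gamma γ * ProbabilityTheory.mgf id μ z) ∧
      ∀ z, ProbabilityTheory.mgf id μ z = ∫ τ in Ioi (0 : ℝ),
        lconv (fun u => u ^ (β - α * γ - 1) / Real.Gamma (β - α * γ)) f (τ ^ (-(1 / α))) *
          τ ^ ((β - 1) / α - 1) * Real.exp (z * τ) := by
  have hfm : AEMeasurable f (volume.restrict (Ioi 0)) := hf_int.aemeasurable
  obtain ⟨F, hF, hfF⟩ := hfm.ennreal_ofReal
  have hL : ∀ s > (0 : ℝ), ∫⁻ u in Ioi 0, ENNReal.ofReal (Real.exp (-(s * u))) * F u =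
      ENNReal.ofReal (Real.exp (-(s ^ α))) := by
    intro s hs
    rw [← lintegral_ofReal_eq_of_integral_pos measurableSet_Ioi
      (fun t ht => mul_nonneg (Real.exp_pos _).le (hf_pos t ht).le) (Real.exp_pos _) (hf_lt s hs)]
    refine lintegral_congr_ae ?_
    filter_upwards [hfF] with u hu
    rw [← hu, ENNReal.ofReal_mul (Real.exp_pos _).le]
  have hδ : 0 < β - α * γ := sub_pos.2 hβ
  have hβ0 : 0 < β := (mul_pos hα hγ).trans hβ
  have hGδ := Real.Gamma_pos_of_pos hδ
  set ρ : ℝ → ℝ := fun u => u ^ (β - α * γ - 1) / Real.Gamma (β - α * γ)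
  have hρ : Measurable ρ := measurable_rpow_div_Gamma _
  have hconv := lconv_eq_toReal_lconvENN hρ (fun v hv => by positivity) hfm
    (fun x hx => (hf_pos x hx).le) hfF
  set G : ℝ → ℝ≥0∞ := fun τ => lconvENN ρ F (τ ^ (-(1 / α))) *
    ENNReal.ofReal (τ ^ ((β - 1) / α - 1)) with hG
  have hGm : Measurable G :=
    ((measurable_lconvENN hρ hF).comp (by fun_prop)).mul (by fun_prop)
  have hmom (k : ℕ) : ∫⁻ τ in Ioi 0, G τ * ENNReal.ofReal (τ ^ k) =
      ENNReal.ofReal (Real.Gamma (γ + k) / Real.Gamma (α * k + β)) :=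
    lintegral_moment_lconvENN_stable hα hγ hβ hF hL k
  have hGfin : ∀ᵐ τ ∂volume.restrict (Ioi 0), G τ < ∞ := by
    refine ae_lt_top hGm ?_
    have h0 := hmom 0
    simp only [pow_zero, ENNReal.ofReal_one, mul_one] at h0
    rw [h0]
    exact ENNReal.ofReal_ne_top
  set μ := (volume.restrict (Ioi (0 : ℝ))).withDensity G
  have hμ : ∀ᵐ x ∂μ, 0 < x :=
    (withDensity_absolutelyContinuous _ _).ae_le (ae_restrict_mem measurableSet_Ioi)
  have hm (k : ℕ) : ∫⁻ x, ENNReal.ofReal (x ^ k) ∂μ =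
      ENNReal.ofReal (Real.Gamma (γ + k) / Real.Gamma (α * k + β)) := by
    rw [lintegral_withDensity_eq_lintegral_mul _ hGm (by fun_prop), ← hmom]
    rfl
  have hm0 (k : ℕ) : 0 ≤ Real.Gamma (γ + k) / Real.Gamma (α * k + β) :=
    div_nonneg (Real.Gamma_pos_of_pos (by positivity)).le
      (Real.Gamma_pos_of_pos (by positivity)).le
  have hs := summable_Gamma_div_Gamma_mul_pow hα hα1 hγ hβ0
  refine ⟨μ, hμ, integrable_exp_mul_of_moments hμ hm0 hm hs, fun z => ?_, fun z => ?_⟩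
  · rw [mgf_eq_tsum_of_moments hμ hm0 hm hs, mittagLeffler3]
    congr 1
    refine tsum_congr fun k => ?_
    field_simp
  · rw [ProbabilityTheory.mgf, integral_withDensity_eq_integral_toReal_smul hGm hGfin]
    refine setIntegral_congr_fun measurableSet_Ioi fun τ hτ => ?_
    simp only [hG, id, smul_eq_mul, hconv, ENNReal.toReal_mul]
    rw [ENNReal.toReal_ofReal (Real.rpow_nonneg (le_of_lt hτ) _)]

theorem prabhakar_representation (α β γ lam : ℝ) (hα : 0 < α) (hα1 : α < 1)
    (hγ : 0 < γ) (hβ : α * γ < β) (hlam : 0 < lam) (f : ℝ → ℝ)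
    (hf_pos : ∀ x > (0 : ℝ), 0 < f x)
    (hf_prob : ∫ x in Set.Ioi (0 : ℝ), f x = 1)
    (hf_lt : ∀ s > (0 : ℝ),
      ∫ t in Set.Ioi (0 : ℝ), Real.exp (-(s * t)) * f t = Real.exp (-(s ^ α))) :
    (∀ x > (0 : ℝ),
      mittagLeffler3 α β γ (-(lam * x ^ α)) =
        x ^ (1 - β) / Real.Gamma γ *
          ∫ t in Set.Ioi (0 : ℝ),
            lconv (fun u => u ^ (β - α * γ - 1) / Real.Gamma (β - α * γ)) f
                (x * t ^ (-(1 / α))) *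
              t ^ ((β - 1) / α - 1) * Real.exp (-(lam * t))) ∧
      CompletelyMonotoneOn (fun x : ℝ => mittagLeffler3 α β γ (-x)) := by
  have hf_int : IntegrableOn f (Ioi 0) := by
    by_contra hn
    rw [integral_undef hn] at hf_prob
    exact zero_ne_one hf_prob
  obtain ⟨μ, hμ, hint, hE, hmgf⟩ :=
    exists_measure_mittagLeffler3_eq_mgf hα hα1 hγ hβ hf_pos hf_int hf_lt
  refine ⟨fun x hx => ?_, ?_⟩
  · rw [hE, hmgf, ← setIntegral_comp_mul_rpow_neg_inv hα hx, one_div_mul_eq_div, mul_div_right_comm]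
  · simp_rw [hE]
    exact completelyMonotoneOn_const_mul_mgf_neg hμ hint
      (one_div_nonneg.2 (Real.Gamma_pos_of_pos hγ).le)
end

section
/- For 0 < α < 1 and λ > 0, the measure dR_α(u|λ) = (1/π) · λ u^{α-1} sin(πα) / (λ² + 2λ u^α cos(πα) + u^{2α}) du on (0,∞) is a nonnegative measure whose Laplace transform is the Mittag-Leffler function: ∫₀^∞ e^{-x u} dR_α(u|λ) = E_α(-λ x^α) for all x > 0. -/
open MeasureTheory Filter Topology Set Complex

/-- The integral of `f` over the boundary of the half-strip `{b ≤ re w, |im w| ≤ π}`, that is,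
Hankel's contour in the logarithmic coordinate. -/
noncomputable def hankelIntegral (b : ℝ) (f : ℂ → ℂ) : ℂ :=
  (∫ r in Ioi b, (f (r + Real.pi * I) - f (r - Real.pi * I))) +
    I * ∫ θ in (-Real.pi)..Real.pi, f (b + θ * I)

/-- Moving Hankel's contour to the left until it collapses onto the two boundary lines. -/
theorem hankelIntegral_eq_integral_add {f : ℂ → ℂ} (b : ℝ) {l : ℂ} {B : ℝ → ℝ}
    (hf : ∀ w : ℂ, |w.im| ≤ Real.pi → DifferentiableAt ℂ f w)
    (hint : Integrable fun r : ℝ ↦ f (r + Real.pi * I) - f (r - Real.pi * I))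
    (hB : Tendsto B atBot (𝓝 0))
    (hfB : ∀ᶠ a : ℝ in atBot, ∀ θ : ℝ, |θ| ≤ Real.pi → ‖f (a + θ * I) - l‖ ≤ B a) :
    hankelIntegral b f =
      (∫ r : ℝ, (f (r + Real.pi * I) - f (r - Real.pi * I))) + 2 * Real.pi * I * l := by
  have hpi := Real.pi_pos
  have hline : ∀ y : ℝ, |y| ≤ Real.pi → Continuous fun r : ℝ ↦ f (r + y * I) := by
    intro y hy
    refine continuous_iff_continuousAt.2 fun r ↦ ?_
    have h1 : ContinuousAt f ((r : ℂ) + y * I) := (hf _ (by simpa using hy)).continuousAt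
    exact ContinuousAt.comp (f := fun r : ℝ ↦ (r : ℂ) + y * I) h1 (by fun_prop)
  have hvert : ∀ a : ℝ, ContinuousOn (fun θ : ℝ ↦ f (a + θ * I)) (uIcc (-Real.pi) Real.pi) := by
    intro a θ hθ
    rw [uIcc_of_le (by linarith)] at hθ
    have h1 : ContinuousAt f ((a : ℂ) + θ * I) :=
      (hf _ (by simpa using abs_le.2 ⟨hθ.1, hθ.2⟩)).continuousAt
    exact (ContinuousAt.comp (f := fun θ : ℝ ↦ (a : ℂ) + θ * I) h1
      (by fun_prop)).continuousWithinAt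
  have hrect : ∀ a : ℝ, (I * ∫ θ in (-Real.pi)..Real.pi, f (b + θ * I)) =
      (∫ r in a..b, (f (r + Real.pi * I) - f (r - Real.pi * I))) +
        I * ∫ θ in (-Real.pi)..Real.pi, f (a + θ * I) := by
    intro a
    have h := integral_boundary_rect_eq_zero_of_differentiableOn f
      (a + (-Real.pi : ℝ) * I) (b + Real.pi * I) (by
        intro w hw
        have h2 := (mem_reProdIm.1 hw).2
        simp only [add_im, ofReal_im, mul_im, ofReal_re, I_im, mul_one, I_re, mul_zero,
          add_zero, zero_add] at h2
        rw [uIcc_of_le (by linarith)] at h2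
        exact (hf w (abs_le.2 ⟨h2.1, h2.2⟩)).differentiableWithinAt)
    simp only [add_im, ofReal_im, mul_im, ofReal_re, I_im, mul_one, I_re, mul_zero,
      add_zero, zero_add, add_re, mul_re, sub_self, smul_eq_mul] at h
    have h1 := (hline Real.pi (abs_of_pos hpi).le).intervalIntegrable (μ := volume) a b
    have h2 := (hline (-Real.pi) (by rw [abs_neg, abs_of_pos hpi])).intervalIntegrable
      (μ := volume) a b
    simp only [ofReal_neg, neg_mul, ← sub_eq_add_neg] at h h2
    rw [intervalIntegral.integral_sub h1 h2]
    linear_combination h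
  have hlim : Tendsto (fun a : ℝ ↦ ∫ θ in (-Real.pi)..Real.pi, f (a + θ * I)) atBot
      (𝓝 (2 * Real.pi * l)) := by
    rw [tendsto_iff_norm_sub_tendsto_zero]
    refine squeeze_zero' (Eventually.of_forall fun _ ↦ norm_nonneg _) ?_
      (by simpa only [zero_mul] using hB.mul_const |Real.pi - -Real.pi|)
    filter_upwards [hfB] with a ha
    have h1 : (2 * Real.pi * l : ℂ) = ∫ _ in (-Real.pi)..Real.pi, l := by
      rw [intervalIntegral.integral_const, real_smul]; push_cast; ring
    rw [h1, ← intervalIntegral.integral_sub (hvert a).intervalIntegrable (by simp)]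
    refine intervalIntegral.norm_integral_le_of_norm_le_const fun θ hθ ↦ ha θ ?_
    rw [uIoc_of_le (by linarith)] at hθ
    exact abs_le.2 ⟨hθ.1.le, hθ.2⟩
  have hcol : (I * ∫ θ in (-Real.pi)..Real.pi, f (b + θ * I)) =
      (∫ r in Iic b, (f (r + Real.pi * I) - f (r - Real.pi * I))) +
        I * (2 * Real.pi * l) := by
    refine tendsto_nhds_unique (tendsto_const_nhds (f := (atBot : Filter ℝ))) ?_
    refine Tendsto.congr (fun a ↦ (hrect a).symm) ?_
    exact (intervalIntegral_tendsto_integral_Iic b hint.integrableOn tendsto_id).add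
      (hlim.const_mul I)
  rw [hankelIntegral, hcol, ← intervalIntegral.integral_Iic_add_Ioi hint.integrableOn
    hint.integrableOn (b := b)]
  ring

theorem hasSum_hankelIntegral {f : ℕ → ℂ → ℂ} {F : ℂ → ℂ} {b q : ℝ} (hq0 : 0 ≤ q) (hq1 : q < 1)
    (hf : ∀ k, Continuous (f k))
    (hbound : ∀ k (w : ℂ), b ≤ w.re → ‖f k w‖ ≤ q ^ k * ‖exp (exp w)‖)
    (hsum : ∀ w : ℂ, b ≤ w.re → |w.im| ≤ Real.pi → HasSum (fun k ↦ f k w) (F w)) :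
    HasSum (fun k ↦ hankelIntegral b (f k)) (hankelIntegral b F) := by
  have hpi := Real.pi_pos
  have hgeo := summable_geometric_of_lt_one hq0 hq1
  refine HasSum.add ?_ (HasSum.mul_left I ?_)
  · refine hasSum_integral_of_dominated_convergence
      (fun k (r : ℝ) ↦ q ^ k * (‖exp (exp (r + Real.pi * I))‖ + ‖exp (exp (r - Real.pi * I))‖))
      (fun k ↦ ?_) (fun k ↦ ?_) ?_ ?_ ?_
    · have := hf k
      exact Continuous.aestronglyMeasurable (by fun_prop)
    · refine (ae_restrict_iff' measurableSet_Ioi).2 (Eventually.of_forall fun r hr ↦ ?_)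
      have hr' : b ≤ r := le_of_lt hr
      rw [mul_add]
      exact (norm_sub_le _ _).trans
        (add_le_add (hbound k _ (by simpa using hr')) (hbound k _ (by simpa using hr')))
    · exact Eventually.of_forall fun r ↦ hgeo.mul_right _
    · simp_rw [tsum_mul_right]
      refine Integrable.const_mul ?_ _
      have h : ∀ r : ℝ, ‖exp (exp (r + Real.pi * I))‖ + ‖exp (exp (r - Real.pi * I))‖ =
          Real.exp r * (2 * (Real.exp (-Real.exp r) * (Real.exp r) ^ ((0 : ℝ) - 1))) := by
        intro r
        rw [exp_add_pi_mul_I, exp_sub_pi_mul_I, ← ofReal_exp, ← ofReal_neg, ← ofReal_exp,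
          norm_real, Real.norm_of_nonneg (Real.exp_pos _).le, zero_sub, Real.rpow_neg_one]
        field_simp
        ring
      simp_rw [h]
      refine (integrableOn_comp_exp_Ioi (fun u ↦ 2 * (Real.exp (-u) * u ^ ((0 : ℝ) - 1))) b).2 ?_
      have hb := Real.exp_pos b
      refine Integrable.mono' (((integrableOn_exp_neg_Ioi (Real.exp b)).const_mul
        (2 * (Real.exp b)⁻¹))) ?_ ?_
      · exact Measurable.aestronglyMeasurable (by fun_prop)
      · refine (ae_restrict_iff' measurableSet_Ioi).2 (Eventually.of_forall fun u hu ↦ ?_)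
        have hu' : Real.exp b < u := hu
        have hu0 : 0 < u := hb.trans hu'
        rw [Real.norm_of_nonneg (by positivity), zero_sub, Real.rpow_neg_one, mul_assoc,
          mul_comm (Real.exp (-u))]
        gcongr
    · refine (ae_restrict_iff' measurableSet_Ioi).2 (Eventually.of_forall fun r hr ↦ ?_)
      have hr' : b ≤ r := le_of_lt hr
      exact (hsum _ (by simpa using hr') (by simp [abs_of_pos hpi])).sub
        (hsum _ (by simpa using hr') (by simp [abs_of_pos hpi]))
  · refine intervalIntegral.hasSum_integral_of_dominated_convergence
      (fun k (θ : ℝ) ↦ q ^ k * ‖exp (exp (b + θ * I))‖)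
      (fun k ↦ ?_) (fun k ↦ ?_) ?_ ?_ ?_
    · have := hf k
      exact Continuous.aestronglyMeasurable (by fun_prop)
    · exact Eventually.of_forall fun θ _ ↦ hbound k _ (by simp)
    · exact Eventually.of_forall fun θ _ ↦ hgeo.mul_right _
    · simp_rw [tsum_mul_right]
      exact Continuous.intervalIntegrable (by fun_prop) _ _
    · refine Eventually.of_forall fun θ hθ ↦ hsum _ (by simp) ?_
      rw [uIoc_of_le (by linarith)] at hθ
      simpa using abs_le.2 ⟨hθ.1.le, hθ.2⟩

theorem integral_Ioi_zero_eq_integral_exp {E : Type*} [NormedAddCommGroup E] [NormedSpace ℝ E]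
    (g : ℝ → E) : ∫ u in Ioi (0 : ℝ), g u = ∫ r : ℝ, Real.exp r • g (Real.exp r) := by
  have h := integral_image_eq_integral_abs_deriv_smul MeasurableSet.univ
    (fun x _ ↦ (Real.hasDerivAt_exp x).hasDerivWithinAt) Real.exp_injective.injOn g
  simpa [image_univ, Real.range_exp, abs_of_pos (Real.exp_pos _)] using h

theorem integrableOn_Ioi_zero_iff_integrable_exp {E : Type*} [NormedAddCommGroup E]
    [NormedSpace ℝ E] (g : ℝ → E) :
    IntegrableOn g (Ioi 0) ↔ Integrable fun r : ℝ ↦ Real.exp r • g (Real.exp r) := by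
  have h := integrableOn_image_iff_integrableOn_abs_deriv_smul MeasurableSet.univ
    (fun x _ ↦ (Real.hasDerivAt_exp x).hasDerivWithinAt) Real.exp_injective.injOn g
  simpa [image_univ, Real.range_exp, abs_of_pos (Real.exp_pos _)] using h

theorem exp_mul_exp_neg_exp_mul_rpow (c r : ℝ) :
    Real.exp r • (Real.exp (-Real.exp r) * Real.exp r ^ (c - 1)) =
      Real.exp (-Real.exp r + c * r) := by
  rw [← Real.exp_mul, smul_eq_mul, ← Real.exp_add, ← Real.exp_add]
  congr 1; ring

theorem integrable_exp_neg_exp_add {c : ℝ} (hc : 0 < c) :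
    Integrable fun r : ℝ ↦ Real.exp (-Real.exp r + c * r) := by
  have h := (integrableOn_Ioi_zero_iff_integrable_exp _).1 (Real.GammaIntegral_convergent hc)
  simpa only [exp_mul_exp_neg_exp_mul_rpow] using h

theorem integral_exp_neg_exp_add {c : ℝ} (hc : 0 < c) :
    ∫ r : ℝ, Real.exp (-Real.exp r + c * r) = Real.Gamma c := by
  rw [Real.Gamma_eq_integral hc, integral_Ioi_zero_eq_integral_exp]
  simp only [exp_mul_exp_neg_exp_mul_rpow]

theorem integrableOn_exp_neg_exp_add (c b : ℝ) :
    IntegrableOn (fun r : ℝ ↦ Real.exp (-Real.exp r + c * r)) (Ioi b) := by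
  have h1 := (integrable_exp_neg_exp_add (c := |c| + 1) (by positivity)).integrableOn (s := Ioi b)
  refine Integrable.mono' (h1.const_mul (Real.exp ((c - |c| - 1) * b)))
    (Continuous.aestronglyMeasurable (by fun_prop)) ?_
  refine (ae_restrict_iff' measurableSet_Ioi).2 (Eventually.of_forall fun r hr ↦ ?_)
  have hr' : b < r := hr
  rw [Real.norm_of_nonneg (Real.exp_pos _).le, ← Real.exp_add, Real.exp_le_exp]
  nlinarith [le_abs_self c]

/-- The integrand of Hankel's formula in the logarithmic coordinate. -/
noncomputable def hankelKernel (c : ℝ) (w : ℂ) : ℂ := exp (exp w + c * w)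

theorem hasDerivAt_hankelKernel (c : ℝ) (w : ℂ) :
    HasDerivAt (hankelKernel c) (hankelKernel (c + 1) w + c * hankelKernel c w) w := by
  have h := ((Complex.hasDerivAt_exp w).add ((hasDerivAt_id w).const_mul (c : ℂ))).cexp
  refine h.congr_deriv ?_
  simp only [hankelKernel, ofReal_add, ofReal_one, Pi.add_apply, id]
  rw [add_mul, one_mul, ← add_assoc, exp_add (exp w + c * w) w]
  ring

theorem continuous_hankelKernel (c : ℝ) : Continuous (hankelKernel c) := by
  unfold hankelKernel; fun_prop

theorem hankelKernel_jump (c r : ℝ) :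
    hankelKernel c (r + Real.pi * I) - hankelKernel c (r - Real.pi * I) =
      ((Real.exp (-Real.exp r + c * r) : ℝ) : ℂ) * (2 * I * (Real.sin (Real.pi * c) : ℝ)) := by
  have h1 : -exp (r : ℂ) + c * (r + Real.pi * I) = (-exp (r : ℂ) + c * r) + (Real.pi * c) * I := by
    ring
  have h2 : -exp (r : ℂ) + c * (r - Real.pi * I) =
      (-exp (r : ℂ) + c * r) + (-(Real.pi * c)) * I := by
    ring
  simp only [hankelKernel]
  rw [exp_add_pi_mul_I, exp_sub_pi_mul_I, h1, h2, exp_add _ (_ * I), exp_add _ (_ * I)]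
  push_cast
  rw [Complex.sin]
  linear_combination (exp (-exp (r : ℂ) + c * r) *
    (exp ((Real.pi * c) * I) - exp (-(Real.pi * c) * I))) * I_sq

theorem norm_exp_exp_le (w : ℂ) : ‖exp (exp w)‖ ≤ Real.exp (Real.exp w.re) := by
  rw [Complex.norm_exp, ← Complex.norm_exp w]
  exact Real.exp_le_exp.2 (re_le_norm _)

theorem tendsto_exp_exp_atBot : Tendsto (fun a : ℝ ↦ Real.exp (Real.exp a)) atBot (𝓝 1) := by
  have h := (Real.continuous_exp.tendsto 0).comp Real.tendsto_exp_atBot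
  simpa [Function.comp_def] using h

theorem hankelIntegral_kernel_of_pos (b : ℝ) {c : ℝ} (hc : 0 < c) :
    hankelIntegral b (hankelKernel c) = 2 * Real.pi * I / (Real.Gamma (1 - c) : ℝ) := by
  have hB : Tendsto (fun a ↦ Real.exp (Real.exp a) * Real.exp (c * a)) atBot (𝓝 0) := by
    simpa using tendsto_exp_exp_atBot.mul
      (Real.tendsto_exp_atBot.comp (tendsto_id.const_mul_atBot hc))
  rw [hankelIntegral_eq_integral_add b (l := 0)
    (fun w _ ↦ (hasDerivAt_hankelKernel c w).differentiableAt) ?_ hB ?_]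
  · simp_rw [hankelKernel_jump]
    rw [integral_mul_const, integral_complex_ofReal, integral_exp_neg_exp_add hc]
    have hG := Real.Gamma_mul_Gamma_one_sub c
    have hG0 := (Real.Gamma_pos_of_pos hc).ne'
    by_cases hs : Real.sin (Real.pi * c) = 0
    · rw [hs, div_zero] at hG
      have : Real.Gamma (1 - c) = 0 := (mul_eq_zero.1 hG).resolve_left hG0
      simp [this, hs]
    · have h1 : Real.Gamma (1 - c) ≠ 0 := by
        intro h0
        rw [h0, mul_zero] at hG
        exact div_ne_zero Real.pi_ne_zero hs hG.symm
      have h2 : Real.Gamma c * Real.Gamma (1 - c) * Real.sin (Real.pi * c) = Real.pi := by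
        rw [hG, div_mul_cancel₀ _ hs]
      have h3 := congrArg ((↑) : ℝ → ℂ) h2
      push_cast at h3 ⊢
      rw [eq_div_iff (by exact_mod_cast h1)]
      linear_combination (2 * I) * h3
  · simp_rw [hankelKernel_jump]
    exact (integrable_exp_neg_exp_add hc).ofReal.mul_const _
  · refine Eventually.of_forall fun a θ _ ↦ ?_
    rw [sub_zero, hankelKernel, exp_add, norm_mul]
    refine mul_le_mul ((norm_exp_exp_le _).trans (by simp)) ?_ (norm_nonneg _) (Real.exp_pos _).le
    rw [Complex.norm_exp]; simp

theorem hankelIntegral_kernel_zero (b : ℝ) :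
    hankelIntegral b (hankelKernel 0) = 2 * Real.pi * I := by
  have hB : Tendsto (fun a ↦ 2 * Real.exp a) atBot (𝓝 0) := by
    simpa using Real.tendsto_exp_atBot.const_mul 2
  have hj : ∀ r : ℝ, hankelKernel 0 (r + Real.pi * I) - hankelKernel 0 (r - Real.pi * I) = 0 := by
    intro r; simp [hankelKernel_jump]
  rw [hankelIntegral_eq_integral_add b (l := 1)
    (fun w _ ↦ (hasDerivAt_hankelKernel 0 w).differentiableAt) ?_ hB ?_]
  · simp [hj]
  · simp [hj]
  · filter_upwards [eventually_le_atBot (0 : ℝ)] with a ha θ _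
    have h : ‖exp (a + θ * I)‖ = Real.exp a := by rw [Complex.norm_exp]; simp
    have h1 := norm_exp_sub_one_le (x := exp (a + θ * I)) (by rw [h]; exact Real.exp_le_one_iff.2 ha)
    simpa [hankelKernel, h] using h1

theorem hankelIntegral_kernel_add_one (b c : ℝ) :
    hankelIntegral b (hankelKernel (c + 1)) = -c * hankelIntegral b (hankelKernel c) := by
  have hint : ∀ c : ℝ, IntegrableOn (fun r : ℝ ↦
      hankelKernel c (r + Real.pi * I) - hankelKernel c (r - Real.pi * I)) (Ioi b) := by
    intro c
    simp_rw [hankelKernel_jump]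
    exact (integrableOn_exp_neg_exp_add c b).ofReal.mul_const _
  have h1 : ∫ r in Ioi b, ((hankelKernel (c + 1) (r + Real.pi * I) -
        hankelKernel (c + 1) (r - Real.pi * I)) +
      c * (hankelKernel c (r + Real.pi * I) - hankelKernel c (r - Real.pi * I))) =
      0 - (hankelKernel c (b + Real.pi * I) - hankelKernel c (b - Real.pi * I)) := by
    refine integral_Ioi_of_hasDerivAt_of_tendsto' (f := fun r : ℝ ↦
      hankelKernel c (r + Real.pi * I) - hankelKernel c (r - Real.pi * I)) (fun r _ ↦ ?_)
      (Integrable.add (hint (c + 1)) ((hint c).const_mul (c : ℂ))) ?_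
    · have e1 : HasDerivAt (fun r : ℝ ↦ (r : ℂ) + Real.pi * I) 1 r :=
        (hasDerivAt_id r).ofReal_comp.add_const _
      have e2 : HasDerivAt (fun r : ℝ ↦ (r : ℂ) - Real.pi * I) 1 r :=
        (hasDerivAt_id r).ofReal_comp.sub_const _
      have d := ((hasDerivAt_hankelKernel c _).comp r e1).sub
        ((hasDerivAt_hankelKernel c _).comp r e2)
      refine d.congr_deriv ?_
      ring
    · simp_rw [hankelKernel_jump]
      have ht : Tendsto (fun r : ℝ ↦ Real.exp (-Real.exp r + c * r)) atTop (𝓝 0) := by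
        have := tendsto_rpow_mul_exp_neg_mul_atTop_nhds_zero c 1 one_pos
        refine (this.comp Real.tendsto_exp_atTop).congr fun r ↦ ?_
        simp only [Function.comp_apply]
        rw [← Real.exp_mul, ← Real.exp_add]
        congr 1; ring
      have := ((continuous_ofReal.tendsto 0).comp ht).mul_const
        (2 * I * (Real.sin (Real.pi * c) : ℝ))
      simpa [Function.comp_def] using this
  have h2 : ∫ θ in (-Real.pi)..Real.pi, (hankelKernel (c + 1) (b + θ * I) +
      c * hankelKernel c (b + θ * I)) * I =
      hankelKernel c (b + Real.pi * I) - hankelKernel c (b - Real.pi * I) := by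
    have hc1 := continuous_hankelKernel c
    have hc2 := continuous_hankelKernel (c + 1)
    rw [intervalIntegral.integral_eq_sub_of_hasDerivAt
      (f := fun θ : ℝ ↦ hankelKernel c (b + θ * I)) (fun θ _ ↦ ?_)
      (Continuous.intervalIntegrable (by fun_prop) _ _)]
    · simp [sub_eq_add_neg]
    · have e : HasDerivAt (fun θ : ℝ ↦ (b : ℂ) + θ * I) I θ := by
        simpa using ((hasDerivAt_id θ).ofReal_comp.mul_const I).const_add (b : ℂ)
      exact (hasDerivAt_hankelKernel c _).comp θ e
  rw [integral_add (hint (c + 1)) ((hint c).const_mul _), integral_const_mul] at h1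
  have hvert : ∀ c : ℝ, IntervalIntegrable (fun θ : ℝ ↦ hankelKernel c (b + θ * I)) volume
      (-Real.pi) Real.pi := fun c ↦
    ((continuous_hankelKernel c).comp (by fun_prop)).intervalIntegrable _ _
  rw [intervalIntegral.integral_mul_const,
    intervalIntegral.integral_add (hvert _) ((hvert c).const_mul _),
    intervalIntegral.integral_const_mul] at h2
  simp only [hankelIntegral]
  linear_combination h1 + h2

/-- **Hankel's formula** for the reciprocal Gamma function at real arguments. -/
theorem hankelIntegral_kernel (b c : ℝ) :
    hankelIntegral b (hankelKernel c) = 2 * Real.pi * I / (Real.Gamma (1 - c) : ℝ) := by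
  obtain ⟨n, hn⟩ := exists_nat_gt (-c)
  induction n generalizing c with
  | zero => exact hankelIntegral_kernel_of_pos b (by simpa using hn)
  | succ n ih =>
    rcases lt_trichotomy c 0 with hc | rfl | hc
    · have h := ih (c + 1) (by push_cast at hn; linarith)
      rw [hankelIntegral_kernel_add_one, show 1 - (c + 1) = -c by ring] at h
      have hG := Real.Gamma_add_one (s := -c) (by linarith)
      rw [show 1 - c = -c + 1 by ring, hG]
      have h0 : (Real.Gamma (-c) : ℂ) ≠ 0 := by
        exact_mod_cast (Real.Gamma_pos_of_pos (neg_pos.2 hc)).ne'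
      have hc0 : (c : ℂ) ≠ 0 := by exact_mod_cast hc.ne
      push_cast at h ⊢
      rw [eq_div_iff h0] at h
      rw [eq_div_iff (mul_ne_zero (neg_ne_zero.2 hc0) h0)]
      linear_combination h
    · simp [hankelIntegral_kernel_zero]
    · exact hankelIntegral_kernel_of_pos b hc

theorem one_add_mul_cos_add_sq_pos {α t : ℝ} (hα : 0 < α) (hα1 : α < 1) :
    0 < 1 + 2 * t * Real.cos (Real.pi * α) + t ^ 2 := by
  have hs : 0 < Real.sin (Real.pi * α) :=
    Real.sin_pos_of_pos_of_lt_pi (by positivity) (by nlinarith [Real.pi_pos])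
  nlinarith [sq_nonneg (t + Real.cos (Real.pi * α)), Real.sin_sq_add_cos_sq (Real.pi * α)]

theorem one_add_mul_exp_ne_zero {α z : ℝ} (hα : 0 < α) (hα1 : α < 1) (hz : 0 < z) {w : ℂ}
    (hw : |w.im| ≤ Real.pi) : 1 + z * exp (-(α * w)) ≠ 0 := by
  intro h
  have him := congrArg Complex.im h
  have hre := congrArg Complex.re h
  simp only [add_im, one_im, re_ofReal_mul, im_ofReal_mul, exp_im, exp_re, neg_im, neg_re,
    zero_im, zero_re, add_re, one_re, zero_add] at him hre
  have hE := Real.exp_pos (-(α * w.re))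
  have hsin : Real.sin (-(α * w.im)) = 0 := by
    rcases mul_eq_zero.1 him with h' | h'
    · exact absurd h' hz.ne'
    · exact (mul_eq_zero.1 h').resolve_left hE.ne'
  have hpi := Real.pi_pos
  obtain ⟨h1, h2⟩ := abs_le.1 hw
  have h3 := (Real.sin_eq_zero_iff_of_lt_of_lt (by nlinarith) (by nlinarith)).1 hsin
  rw [h3, Real.cos_zero] at hre
  have : 0 < z * (Real.exp (-(α * w.re)) * 1) := by positivity
  linarith

theorem mittagLeffler_integrand_jump {α z : ℝ} (hα : 0 < α) (hα1 : α < 1) (hz : 0 < z) (r : ℝ) :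
    exp (exp (r + Real.pi * I)) * (1 + z * exp (-(α * (r + Real.pi * I))))⁻¹ -
        exp (exp (r - Real.pi * I)) * (1 + z * exp (-(α * (r - Real.pi * I))))⁻¹ =
      2 * I * ((Real.exp (-Real.exp r) * (z * Real.exp (-(α * r)) * Real.sin (Real.pi * α)) /
        (1 + 2 * (z * Real.exp (-(α * r))) * Real.cos (Real.pi * α) +
          (z * Real.exp (-(α * r))) ^ 2) : ℝ) : ℂ) := by
  have hpi := Real.pi_pos
  have n1 := one_add_mul_exp_ne_zero hα hα1 hz (w := r + Real.pi * I) (by simp [abs_of_pos hpi])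
  have n2 := one_add_mul_exp_ne_zero hα hα1 hz (w := r - Real.pi * I) (by simp [abs_of_pos hpi])
  have n3 : ((1 + 2 * (z * Real.exp (-(α * r))) * Real.cos (Real.pi * α) +
      (z * Real.exp (-(α * r))) ^ 2 : ℝ) : ℂ) ≠ 0 :=
    ofReal_ne_zero.2 (one_add_mul_cos_add_sq_pos hα hα1).ne'
  have e1 : exp (-(α * (r + Real.pi * I))) =
      exp (-(α * r)) * (Complex.cos (Real.pi * α) - Complex.sin (Real.pi * α) * I) := by
    rw [show -((α : ℂ) * (r + Real.pi * I)) = -(α * r) + (-(Real.pi * α)) * I by ring, exp_add,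
      exp_mul_I, Complex.cos_neg, Complex.sin_neg]
    ring
  have e2 : exp (-(α * (r - Real.pi * I))) =
      exp (-(α * r)) * (Complex.cos (Real.pi * α) + Complex.sin (Real.pi * α) * I) := by
    rw [show -((α : ℂ) * (r - Real.pi * I)) = -(α * r) + (Real.pi * α) * I by ring, exp_add,
      exp_mul_I]
  rw [e1] at n1 ⊢
  rw [e2] at n2 ⊢
  rw [exp_add_pi_mul_I, exp_sub_pi_mul_I]
  push_cast at n3 ⊢
  have hsc := Complex.sin_sq_add_cos_sq (Real.pi * α)
  generalize Complex.cos (Real.pi * α) = C at *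
  generalize Complex.sin (Real.pi * α) = S at *
  generalize exp (-((α : ℂ) * r)) = E at *
  have key : (1 + z * (E * (C - S * I))) * (1 + z * (E * (C + S * I))) =
      1 + 2 * (z * E) * C + (z * E) ^ 2 := by
    linear_combination (z * E) ^ 2 * hsc - (z * E) ^ 2 * S ^ 2 * I_sq
  rw [← mul_sub, inv_sub_inv n1 n2, key]
  field_simp
  ring

/-- The spectral representation of the Mittag-Leffler function in the logarithmic coordinate. -/
theorem integral_exp_neg_exp_mul_eq_mittagLeffler {α z : ℝ} (hα : 0 < α) (hα1 : α < 1)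
    (hz : 0 < z) :
    ∫ r : ℝ, Real.exp (-Real.exp r) * (z * Real.exp (-(α * r)) * Real.sin (Real.pi * α)) /
        (1 + 2 * (z * Real.exp (-(α * r))) * Real.cos (Real.pi * α) +
          (z * Real.exp (-(α * r))) ^ 2) = Real.pi * mittagLeffler α (-z) := by
  have hpi := Real.pi_pos
  set F : ℂ → ℂ := fun w ↦ exp (exp w) * (1 + z * exp (-(α * w)))⁻¹ with hF
  have hs : 0 < Real.sin (Real.pi * α) :=
    Real.sin_pos_of_pos_of_lt_pi (by positivity) (by nlinarith)
  set d : ℝ → ℝ := fun r ↦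
    Real.exp (-Real.exp r) * (z * Real.exp (-(α * r)) * Real.sin (Real.pi * α)) /
        (1 + 2 * (z * Real.exp (-(α * r))) * Real.cos (Real.pi * α) +
          (z * Real.exp (-(α * r))) ^ 2) with hd
  have hjump : ∀ r : ℝ, F (r + Real.pi * I) - F (r - Real.pi * I) = 2 * I * (d r : ℂ) :=
    mittagLeffler_integrand_jump hα hα1 hz
  have hdint : Integrable d := by
    have hpos : ∀ r : ℝ, 0 < 1 + 2 * (z * Real.exp (-(α * r))) * Real.cos (Real.pi * α) +
          (z * Real.exp (-(α * r))) ^ 2 := fun r ↦ one_add_mul_cos_add_sq_pos hα hα1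
    refine Integrable.mono' ((integrable_exp_neg_exp_add hα).const_mul
      (z * Real.sin (Real.pi * α))⁻¹) (Continuous.aestronglyMeasurable ?_) ?_
    · exact Continuous.div (by fun_prop) (by fun_prop) fun r ↦ (hpos r).ne'
    · refine Eventually.of_forall fun r ↦ ?_
      have hr := hpos r
      rw [Real.norm_of_nonneg (by positivity), div_le_iff₀ hr, Real.exp_add]
      have hE : Real.exp (α * r) = (Real.exp (-(α * r)))⁻¹ := by rw [Real.exp_neg, inv_inv]
      rw [hE]
      have hE0 := Real.exp_pos (-(α * r))
      set E := Real.exp (-(α * r))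
      have h1 : (z * E * Real.sin (Real.pi * α)) ^ 2 ≤
          1 + 2 * (z * E) * Real.cos (Real.pi * α) + (z * E) ^ 2 := by
        nlinarith [sq_nonneg (1 + z * E * Real.cos (Real.pi * α)),
          Real.sin_sq_add_cos_sq (Real.pi * α)]
      calc Real.exp (-Real.exp r) * (z * E * Real.sin (Real.pi * α))
          = (z * Real.sin (Real.pi * α))⁻¹ * (Real.exp (-Real.exp r) * E⁻¹) *
              (z * E * Real.sin (Real.pi * α)) ^ 2 := by field_simp
        _ ≤ _ := by gcongr
  -- the contour is placed where the geometric series converges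
  obtain ⟨b, hb⟩ : ∃ b : ℝ, z * Real.exp (-(α * b)) < 1 := by
    have : Tendsto (fun b : ℝ ↦ z * Real.exp (-(α * b))) atTop (𝓝 0) := by
      simpa using (Real.tendsto_exp_neg_atTop_nhds_zero.comp
        (tendsto_id.const_mul_atTop hα)).const_mul z
    exact (this.eventually (eventually_lt_nhds one_pos)).exists
  have hcol : hankelIntegral b F = 2 * I * ((∫ r, d r : ℝ) : ℂ) := by
    have hden : Tendsto (fun a : ℝ ↦ z * Real.exp (-(α * a)) - 1) atBot atTop := by
      refine tendsto_atTop_add_const_right _ (-1) (Tendsto.const_mul_atTop hz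
        (Real.tendsto_exp_atTop.comp ?_))
      exact tendsto_neg_atBot_atTop.comp (tendsto_id.const_mul_atBot hα)
    have hB : Tendsto (fun a ↦ Real.exp (Real.exp a) * (z * Real.exp (-(α * a)) - 1)⁻¹) atBot
        (𝓝 0) := by
      simpa using tendsto_exp_exp_atBot.mul hden.inv_tendsto_atTop
    rw [hankelIntegral_eq_integral_add b (l := 0) (fun w hw ↦ ?_) ?_ hB ?_]
    · simp_rw [hjump]
      rw [integral_const_mul, integral_complex_ofReal]
      simp
    · simp_rw [hjump]
      exact hdint.ofReal.const_mul _
    · filter_upwards [hden.eventually_gt_atTop 0] with a ha θ _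
      rw [sub_zero, hF]
      simp only [norm_mul, norm_inv]
      refine mul_le_mul ((norm_exp_exp_le _).trans (by simp)) (inv_anti₀ ha ?_)
        (inv_nonneg.2 (norm_nonneg _)) (Real.exp_pos _).le
      have h1 : ‖(z : ℂ) * exp (-(α * (a + θ * I)))‖ = z * Real.exp (-(α * a)) := by
        rw [norm_mul, Complex.norm_exp, norm_real, Real.norm_of_nonneg hz.le]
        simp
      have h2 := norm_sub_norm_le ((z : ℂ) * exp (-(α * (a + θ * I)))) (-1)
      rw [h1, norm_neg, norm_one, sub_neg_eq_add, add_comm (_ * _)] at h2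
      exact h2
    · have := one_add_mul_exp_ne_zero hα hα1 hz hw
      refine DifferentiableAt.mul (by fun_prop) (DifferentiableAt.inv (by fun_prop) this)
  have hnorm : ∀ w : ℂ, b ≤ w.re → ‖-((z : ℂ) * exp (-(α * w)))‖ ≤ z * Real.exp (-(α * b)) := by
    intro w hw
    rw [norm_neg, norm_mul, Complex.norm_exp, norm_real, Real.norm_of_nonneg hz.le]
    simp only [neg_re, re_ofReal_mul]
    gcongr
  have hsum : HasSum (fun k : ℕ ↦ hankelIntegral b
      (fun w ↦ exp (exp w) * (-(z * exp (-(α * w)))) ^ k)) (hankelIntegral b F) := by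
    refine hasSum_hankelIntegral (q := z * Real.exp (-(α * b))) (by positivity) hb
      (fun k ↦ by fun_prop) (fun k w hw ↦ ?_) (fun w hw _ ↦ ?_)
    · rw [norm_mul, norm_pow, mul_comm]
      gcongr
      exact hnorm w hw
    · have h := hasSum_geometric_of_norm_lt_one ((hnorm w hw).trans_lt hb)
      rw [sub_neg_eq_add] at h
      exact h.mul_left _
  have hterm : ∀ k : ℕ, hankelIntegral b (fun w ↦ exp (exp w) * (-(z * exp (-(α * w)))) ^ k) =
      2 * I * ((Real.pi * ((-z) ^ k / Real.Gamma (α * k + 1)) : ℝ) : ℂ) := by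
    intro k
    have h1 : (fun w ↦ exp (exp w) * (-((z : ℂ) * exp (-(α * w)))) ^ k) =
        fun w ↦ (-z : ℂ) ^ k * hankelKernel (-(α * k)) w := by
      funext w
      rw [hankelKernel, exp_add, neg_mul_eq_neg_mul, mul_pow, ← exp_nat_mul]
      push_cast
      rw [show (k : ℂ) * -(α * w) = -(α * k) * w by ring]
      ring
    have h2 : hankelIntegral b (fun w ↦ (-z : ℂ) ^ k * hankelKernel (-(α * k)) w) =
        (-z : ℂ) ^ k * hankelIntegral b (hankelKernel (-(α * k))) := by
      simp only [hankelIntegral, ← mul_sub]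
      rw [integral_const_mul, intervalIntegral.integral_const_mul]
      ring
    rw [h1, h2, hankelIntegral_kernel, show 1 - -(α * k) = α * k + 1 by ring]
    push_cast
    ring
  simp_rw [hterm] at hsum
  rw [hcol] at hsum
  have h2I : (2 * I : ℂ) ≠ 0 := by simp
  have h := Complex.hasSum_ofReal.1 ((hasSum_mul_left_iff h2I).1 hsum)
  rw [← h.tsum_eq, tsum_mul_left, mittagLeffler]

theorem mittagLeffler_spectral_density (α lam : ℝ) (hα : 0 < α) (hα1 : α < 1)
    (hlam : 0 < lam) :
    (∀ u > (0 : ℝ),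
      0 ≤ (1 / Real.pi) * (lam * u ^ (α - 1) * Real.sin (Real.pi * α)) /
        (lam ^ 2 + 2 * lam * u ^ α * Real.cos (Real.pi * α) + u ^ (2 * α))) ∧
      ∀ x > (0 : ℝ),
        ∫ u in Set.Ioi (0 : ℝ),
            Real.exp (-(x * u)) *
              ((1 / Real.pi) * (lam * u ^ (α - 1) * Real.sin (Real.pi * α)) /
                (lam ^ 2 + 2 * lam * u ^ α * Real.cos (Real.pi * α) + u ^ (2 * α))) =
          mittagLeffler α (-(lam * x ^ α)) := by
  have hs : 0 < Real.sin (Real.pi * α) :=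
    Real.sin_pos_of_pos_of_lt_pi (by positivity) (by nlinarith [Real.pi_pos])
  have hden : ∀ u > (0 : ℝ), lam ^ 2 + 2 * lam * u ^ α * Real.cos (Real.pi * α) + u ^ (2 * α) =
      (u ^ α) ^ 2 * (1 + 2 * (lam / u ^ α) * Real.cos (Real.pi * α) + (lam / u ^ α) ^ 2) := by
    intro u hu
    have hp := Real.rpow_pos_of_pos hu α
    rw [mul_comm 2 α, Real.rpow_mul hu.le, Real.rpow_two]
    field_simp
    ring
  refine ⟨fun u hu ↦ ?_, fun x hx ↦ ?_⟩
  · have hp := Real.rpow_pos_of_pos hu α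
    have hq := one_add_mul_cos_add_sq_pos (t := lam / u ^ α) hα hα1
    rw [hden u hu]
    positivity
  have hz : 0 < lam * x ^ α := by positivity
  have hmain := integral_exp_neg_exp_mul_eq_mittagLeffler hα hα1 hz
  rw [integral_Ioi_zero_eq_integral_exp, ← integral_sub_right_eq_self _ (Real.log x),
    ← mul_right_inj' Real.pi_ne_zero, ← hmain, ← integral_const_mul]
  refine integral_congr_ae (Eventually.of_forall fun r ↦ ?_)
  have hu : Real.exp (r - Real.log x) = Real.exp r / x := by rw [Real.exp_sub, Real.exp_log hx]
  have hu0 := Real.exp_pos (r - Real.log x)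
  have hxu : x * Real.exp (r - Real.log x) = Real.exp r := by rw [hu]; field_simp
  have hp := Real.rpow_pos_of_pos hu0 α
  have ht : lam * x ^ α * Real.exp (-(α * r)) = lam / Real.exp (r - Real.log x) ^ α := by
    have hxp := Real.rpow_pos_of_pos hx α
    rw [hu, Real.div_rpow (Real.exp_pos _).le hx.le, ← Real.exp_mul, mul_comm r, Real.exp_neg]
    field_simp
  simp only [smul_eq_mul]
  rw [hden _ hu0, ht, hxu, Real.rpow_sub_one hu0.ne']
  have hq := one_add_mul_cos_add_sq_pos (t := lam / Real.exp (r - Real.log x) ^ α) hα hα1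
  generalize 1 + 2 * (lam / Real.exp (r - Real.log x) ^ α) * Real.cos (Real.pi * α) +
    (lam / Real.exp (r - Real.log x) ^ α) ^ 2 = Q at *
  field_simp
end
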